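/- Let p : ℝ^n → [1,∞) be measurable with p_- > 1 and p_+ < ∞. Then the Hardy–Littlewood maximal operator M is bounded on L^{p(·)} if and only if p(·) satisfies condition 𝒜, i.e., the averaging operators T_F are bounded on L^{p(·)} uniformly over all families F of pairwise disjoint cubes. -/

import Mathlib

open MeasureTheory ENNReal Set

noncomputable section

/-- An axis-parallel cube in `ℝⁿ`, given by its center and (positive) side length. -/
structure RCube (n : ℕ) where
  center : Fin n → ℝ
  side : ℝ
  side_pos : 0 < side

namespace RCube

/-- The (closed) cube as a subset of `ℝⁿ`. -/
def toSet {n : ℕ} (Q : RCube n) : Set (Fin n → ℝ) :=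
  {x | ∀ i, |x i - Q.center i| ≤ Q.side / 2}

/-- `rQ`: the cube concentric with `Q` whose side length is `r` times that of `Q`. -/
def scaledSet {n : ℕ} (Q : RCube n) (r : ℝ) : Set (Fin n → ℝ) :=
  {x | ∀ i, |x i - Q.center i| ≤ r * Q.side / 2}

end RCube

/-- A family of pairwise disjoint cubes. -/
def PairwiseDisjointCubes {n : ℕ} (F : Set (RCube n)) : Prop :=
  F.Pairwise fun Q₁ Q₂ => Disjoint Q₁.toSet Q₂.toSet

/-- The variable Lebesgue norm `‖f‖_{p(·)}` for a real-valued (finite) exponent,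
applied to an `ℝ≥0∞`-valued function: `inf {λ > 0 : ∫ (f/λ)^{p(x)} dx ≤ 1}`. -/
def vnorm {n : ℕ} (p : (Fin n → ℝ) → ℝ) (f : (Fin n → ℝ) → ℝ≥0∞) : ℝ≥0∞ :=
  sInf {lam : ℝ≥0∞ | 0 < lam ∧ (∫⁻ x, (f x / lam) ^ p x) ≤ 1}

/-- `t^e` for `t, e ∈ [0,∞]`, with the standard variable-exponent convention
`t^∞ = 0` for `t ≤ 1` and `t^∞ = ∞` for `t > 1`. -/
def epow (t e : ℝ≥0∞) : ℝ≥0∞ :=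
  if e = ∞ then (if t ≤ 1 then 0 else ∞) else t ^ e.toReal

/-- The variable Lebesgue norm for an exponent with values in `[1,∞]`. -/
def vnormE {n : ℕ} (p : (Fin n → ℝ) → ℝ≥0∞) (f : (Fin n → ℝ) → ℝ≥0∞) : ℝ≥0∞ :=
  sInf {lam : ℝ≥0∞ | 0 < lam ∧ (∫⁻ x, epow (f x / lam) (p x)) ≤ 1}

/-- `|f|` as an `ℝ≥0∞`-valued function. -/
def ofR {n : ℕ} (f : (Fin n → ℝ) → ℝ) : (Fin n → ℝ) → ℝ≥0∞ :=
  fun x => ENNReal.ofReal |f x|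

/-- The `ℝ≥0∞`-valued characteristic function of a set. -/
def chiE {n : ℕ} (S : Set (Fin n → ℝ)) : (Fin n → ℝ) → ℝ≥0∞ :=
  S.indicator fun _ => 1

/-- The Hardy--Littlewood maximal operator (over axis-parallel cubes containing `x`). -/
def hlMaximal {n : ℕ} (f : (Fin n → ℝ) → ℝ) (x : Fin n → ℝ) : ℝ≥0∞ :=
  ⨆ (Q : RCube n) (_ : x ∈ Q.toSet),
    (∫⁻ y in Q.toSet, ENNReal.ofReal |f y|) / volume Q.toSet

/-- `M` is bounded on `L^{p(·)}`: there is `C > 0` with `‖Mf‖_{p(·)} ≤ C ‖f‖_{p(·)}`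
for every `f ∈ L^{p(·)}`. -/
def MaximalBounded {n : ℕ} (p : (Fin n → ℝ) → ℝ) : Prop :=
  ∃ C > (0 : ℝ), ∀ f : (Fin n → ℝ) → ℝ, Measurable f → vnorm p (ofR f) < ∞ →
    vnorm p (hlMaximal f) ≤ ENNReal.ofReal C * vnorm p (ofR f)

/-- The function `∑_{Q ∈ F} t_Q χ_{E_Q}` (for a pairwise disjoint family,
written as a pointwise supremum). -/
def cubeSum {n : ℕ} (F : Set (RCube n)) (t : RCube n → ℝ)
    (E : RCube n → Set (Fin n → ℝ)) (x : Fin n → ℝ) : ℝ≥0∞ :=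
  ⨆ (Q : RCube n) (_ : Q ∈ F) (_ : x ∈ E Q), ENNReal.ofReal (t Q)

/-- `p(·)` satisfies the `A_∞` condition with parameter `lam` and constant `C`. -/
def AInftyWith {n : ℕ} (p : (Fin n → ℝ) → ℝ) (lam C : ℝ) : Prop :=
  ∀ F : Set (RCube n), PairwiseDisjointCubes F →
    ∀ t : RCube n → ℝ, (∀ Q ∈ F, 0 ≤ t Q) →
      ∀ E : RCube n → Set (Fin n → ℝ),
        (∀ Q ∈ F, MeasurableSet (E Q) ∧ E Q ⊆ Q.toSet ∧
          ENNReal.ofReal lam * volume Q.toSet ≤ volume (E Q)) →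
        vnorm p (cubeSum F t RCube.toSet) ≤ ENNReal.ofReal C * vnorm p (cubeSum F t E)

/-- The `A_∞` condition for a real-valued exponent. -/
def AInfty {n : ℕ} (p : (Fin n → ℝ) → ℝ) : Prop :=
  ∃ lam ∈ Ioo (0 : ℝ) 1, ∃ C > (0 : ℝ), AInftyWith p lam C

/-- `p(·)` satisfies the `A_∞` condition with parameter `lam` and constant `C`
(exponent with values in `[1,∞]`). -/
def AInftyWithE {n : ℕ} (p : (Fin n → ℝ) → ℝ≥0∞) (lam C : ℝ) : Prop :=
  ∀ F : Set (RCube n), PairwiseDisjointCubes F →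
    ∀ t : RCube n → ℝ, (∀ Q ∈ F, 0 ≤ t Q) →
      ∀ E : RCube n → Set (Fin n → ℝ),
        (∀ Q ∈ F, MeasurableSet (E Q) ∧ E Q ⊆ Q.toSet ∧
          ENNReal.ofReal lam * volume Q.toSet ≤ volume (E Q)) →
        vnormE p (cubeSum F t RCube.toSet) ≤ ENNReal.ofReal C * vnormE p (cubeSum F t E)

/-- The `A_∞` condition for an exponent with values in `[1,∞]`. -/
def AInftyE {n : ℕ} (p : (Fin n → ℝ) → ℝ≥0∞) : Prop :=
  ∃ lam ∈ Ioo (0 : ℝ) 1, ∃ C > (0 : ℝ), AInftyWithE p lam C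

/-- The nonincreasing-rearrangement value `(f χ_Q)^*(s) = inf {α : |{x ∈ Q : |f x| > α}| ≤ s}`. -/
def rearr {n : ℕ} (f : (Fin n → ℝ) → ℝ) (Q : RCube n) (s : ℝ≥0∞) : ℝ≥0∞ :=
  sInf {a : ℝ≥0∞ | volume {x | x ∈ Q.toSet ∧ a < ENNReal.ofReal |f x|} ≤ s}

/-- The `λ`-median maximal operator `m_λ`. -/
def medianMax {n : ℕ} (lam : ℝ) (f : (Fin n → ℝ) → ℝ) (x : Fin n → ℝ) : ℝ≥0∞ :=
  ⨆ (Q : RCube n) (_ : x ∈ Q.toSet), rearr f Q (ENNReal.ofReal lam * volume Q.toSet)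

/-- The modified median maximal operator `m_{τ,r}` (supremum over cubes `Q` with `x ∈ rQ`). -/
def medianMaxR {n : ℕ} (tau r : ℝ) (f : (Fin n → ℝ) → ℝ) (x : Fin n → ℝ) : ℝ≥0∞ :=
  ⨆ (Q : RCube n) (_ : x ∈ Q.scaledSet r), rearr f Q (ENNReal.ofReal tau * volume Q.toSet)

/-- The average `⟨f⟩_Q = (1/|Q|) ∫_Q f`. -/
def cubeAvg {n : ℕ} (f : (Fin n → ℝ) → ℝ) (Q : RCube n) : ℝ :=
  (∫ y in Q.toSet, f y) / (volume Q.toSet).toReal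

/-- `|T_F f|` for a pairwise disjoint family `F`, written as a pointwise supremum. -/
def avgSum {n : ℕ} (F : Set (RCube n)) (f : (Fin n → ℝ) → ℝ) (x : Fin n → ℝ) : ℝ≥0∞ :=
  ⨆ (Q : RCube n) (_ : Q ∈ F) (_ : x ∈ Q.toSet), ENNReal.ofReal |cubeAvg f Q|

/-- The reverse Hölder condition `RH`. -/
def RHCond {n : ℕ} (p : (Fin n → ℝ) → ℝ) : Prop :=
  ∃ r : ℝ, 1 < r ∧ ∃ C : ℝ, 0 < C ∧
    ∀ S : Set (RCube n), PairwiseDisjointCubes S →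
      ∀ t : RCube n → ℝ, (∀ Q ∈ S, 0 ≤ t Q) →
        (∑' Q : S, ∫⁻ x in Q.1.toSet, ENNReal.ofReal (t Q.1) ^ p x) ≤ 1 →
        (∑' Q : S, volume Q.1.toSet *
            ((∫⁻ x in Q.1.toSet, ENNReal.ofReal (t Q.1) ^ (r * p x)) / volume Q.1.toSet)
              ^ (1 / r)) ≤ ENNReal.ofReal C


/-! ### Basics -/

/-- open ball in the sup metric (an open cube) -/
def bl {n : ℕ} (P : (Fin n → ℝ) × ℝ) : Set (Fin n → ℝ) := Metric.ball P.1 P.2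

/-- average over the cube -/
def av {n : ℕ} (f : (Fin n → ℝ) → ℝ≥0∞) (P : (Fin n → ℝ) × ℝ) : ℝ≥0∞ :=
  (∫⁻ x in bl P, f x) / volume (bl P)

/-- exponential as an extended nonnegative real -/
def ee (x : ℝ) : ℝ≥0∞ := ENNReal.ofReal (Real.exp x)

lemma ee_pos (x : ℝ) : 0 < ee x := ENNReal.ofReal_pos.2 (Real.exp_pos x)
lemma ee_ne_zero (x : ℝ) : ee x ≠ 0 := (ee_pos x).ne'
lemma ee_ne_top (x : ℝ) : ee x ≠ ∞ := ENNReal.ofReal_ne_top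
lemma ee_zero : ee 0 = 1 := by simp [ee]
lemma ee_add (x y : ℝ) : ee (x + y) = ee x * ee y := by
  rw [ee, ee, ee, Real.exp_add, ENNReal.ofReal_mul (Real.exp_pos x).le]
lemma ee_rpow (x y : ℝ) : ee x ^ y = ee (x * y) := by
  rw [ee, ee, ENNReal.ofReal_rpow_of_pos (Real.exp_pos x), Real.exp_mul]
lemma ee_neg (x : ℝ) : ee (-x) = (ee x)⁻¹ := by
  rw [ee, ee, Real.exp_neg, ENNReal.ofReal_inv_of_pos (Real.exp_pos x)]
lemma ee_sub (x y : ℝ) : ee (x - y) = ee x / ee y := by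
  rw [sub_eq_add_neg, ee_add, ee_neg, div_eq_mul_inv]
lemma ee_le {x y : ℝ} : ee x ≤ ee y ↔ x ≤ y := by
  rw [ee, ee, ENNReal.ofReal_le_ofReal_iff (Real.exp_pos y).le, Real.exp_le_exp]
lemma ee_lt {x y : ℝ} : ee x < ee y ↔ x < y := by
  rw [← not_le, ee_le, not_le]
lemma ee_surj {a : ℝ≥0∞} (h0 : a ≠ 0) (h1 : a ≠ ∞) : ∃ x, a = ee x := by
  refine ⟨Real.log a.toReal, ?_⟩
  rw [ee, Real.exp_log (ENNReal.toReal_pos h0 h1), ENNReal.ofReal_toReal h1]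

section basics
variable {n : ℕ}

lemma bl_isOpen (P : (Fin n → ℝ) × ℝ) : IsOpen (bl P) := Metric.isOpen_ball
lemma bl_meas (P : (Fin n → ℝ) × ℝ) : MeasurableSet (bl P) := (bl_isOpen P).measurableSet
lemma bl_vol_pos {P : (Fin n → ℝ) × ℝ} (h : 0 < P.2) : 0 < volume (bl P) :=
  Metric.measure_ball_pos _ _ h
lemma bl_vol_ne_zero {P : (Fin n → ℝ) × ℝ} (h : 0 < P.2) : volume (bl P) ≠ 0 :=
  (bl_vol_pos h).ne'
lemma bl_vol_ne_top (P : (Fin n → ℝ) × ℝ) : volume (bl P) ≠ ∞ := measure_ball_lt_top.ne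
lemma bl_vol {P : (Fin n → ℝ) × ℝ} (h : 0 < P.2) :
    volume (bl P) = ENNReal.ofReal ((2 * P.2) ^ n) := by
  rw [bl, Real.volume_pi_ball _ h, Fintype.card_fin]

lemma bl_ae_closedBall {P : (Fin n → ℝ) × ℝ} (h : 0 < P.2) :
    bl P =ᵐ[volume] Metric.closedBall P.1 P.2 := by
  refine (ae_eq_of_subset_of_measure_ge Metric.ball_subset_closedBall ?_
    (bl_meas P).nullMeasurableSet measure_closedBall_lt_top.ne)
  rw [bl_vol h, Real.volume_pi_closedBall _ h.le, Fintype.card_fin]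

lemma vol_mul_av (f : (Fin n → ℝ) → ℝ≥0∞) {P : (Fin n → ℝ) × ℝ} (h : 0 < P.2) :
    volume (bl P) * av f P = ∫⁻ x in bl P, f x := by
  rw [av, ENNReal.mul_div_cancel (bl_vol_ne_zero h) (bl_vol_ne_top P)]

lemma av_le_iff {f : (Fin n → ℝ) → ℝ≥0∞} {P : (Fin n → ℝ) × ℝ} (h : 0 < P.2) {t : ℝ≥0∞} :
    av f P ≤ t ↔ ∫⁻ x in bl P, f x ≤ t * volume (bl P) := by
  rw [av, ENNReal.div_le_iff (bl_vol_ne_zero h) (bl_vol_ne_top P)]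

lemma le_av_iff {f : (Fin n → ℝ) → ℝ≥0∞} {P : (Fin n → ℝ) × ℝ} (h : 0 < P.2) {t : ℝ≥0∞} :
    t ≤ av f P ↔ t * volume (bl P) ≤ ∫⁻ x in bl P, f x := by
  rw [av, ENNReal.le_div_iff_mul_le (Or.inl (bl_vol_ne_zero h)) (Or.inl (bl_vol_ne_top P))]

lemma av_mono {f g : (Fin n → ℝ) → ℝ≥0∞} (P : (Fin n → ℝ) × ℝ) (h : ∀ x, f x ≤ g x) :
    av f P ≤ av g P := by
  unfold av; gcongr with x; exact h x

lemma av_const (a : ℝ≥0∞) {P : (Fin n → ℝ) × ℝ} (h : 0 < P.2) : av (fun _ => a) P = a := by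
  rw [av, setLIntegral_const, ENNReal.mul_div_cancel_right (bl_vol_ne_zero h) (bl_vol_ne_top P)]

lemma av_const_mul (a : ℝ≥0∞) (ha : a ≠ ∞) (f : (Fin n → ℝ) → ℝ≥0∞) (P : (Fin n → ℝ) × ℝ) :
    av (fun x => a * f x) P = a * av f P := by
  rw [av, av, lintegral_const_mul' _ _ ha, mul_div_assoc]

lemma av_add {f : (Fin n → ℝ) → ℝ≥0∞} (g : (Fin n → ℝ) → ℝ≥0∞) (hf : Measurable f)
    (P : (Fin n → ℝ) × ℝ) :
    av (fun x => f x + g x) P = av f P + av g P := by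
  rw [av, av, av, lintegral_add_left hf, ENNReal.add_div]

/-! ### dyadic cells -/

/-- dyadic index relative to the cube `P`. -/
def idx (P : (Fin n → ℝ) × ℝ) (m : ℕ) (x : Fin n → ℝ) : Fin n → ℤ :=
  fun l => ⌊2 ^ m * ((x l - P.1 l + P.2) / (2 * P.2))⌋

/-- dyadic subcube -/
def dsub (P : (Fin n → ℝ) × ℝ) (m : ℕ) (i : Fin n → ℤ) : (Fin n → ℝ) × ℝ :=
  (fun l => P.1 l - P.2 + (i l + 1 / 2) * (2 * P.2) / 2 ^ m, P.2 / 2 ^ m)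

lemma idx_eq_iff {P : (Fin n → ℝ) × ℝ} (h : 0 < P.2) (m : ℕ) (x : Fin n → ℝ) (i : Fin n → ℤ) :
    idx P m x = i ↔ ∀ l, -(P.2 / 2 ^ m) ≤ x l - (dsub P m i).1 l ∧
      x l - (dsub P m i).1 l < P.2 / 2 ^ m := by
  rw [funext_iff]
  refine forall_congr' fun l => ?_
  rw [idx, Int.floor_eq_iff]
  have h2 : (0:ℝ) < 2 ^ m := by positivity
  have e1 : (2:ℝ) ^ m * ((x l - P.1 l + P.2) / (2 * P.2)) =
     (x l - (dsub P m i).1 l) / (P.2 / 2 ^ m) / 2 + (i l + 1 / 2) := by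
    simp only [dsub]; field_simp; ring
  rw [e1]
  set y := x l - (dsub P m i).1 l
  set d := P.2 / 2 ^ m with hd
  have hd0 : 0 < d := by positivity
  have e2 : -d ≤ y ↔ -1 ≤ y / d := by rw [le_div_iff₀ hd0]; simp
  have e3 : y < d ↔ y / d < 1 := by rw [div_lt_one hd0]
  rw [e2, e3]
  constructor <;> rintro ⟨h1, h2⟩ <;> constructor <;> linarith

lemma idx_of_mem_bl {P : (Fin n → ℝ) × ℝ} (h : 0 < P.2) {m : ℕ} {x : Fin n → ℝ} {i : Fin n → ℤ}
    (hx : x ∈ bl (dsub P m i)) : idx P m x = i := by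
  rw [idx_eq_iff h]
  intro l
  have hd : (0:ℝ) < (dsub P m i).2 := by simp only [dsub]; positivity
  rw [bl, Metric.mem_ball, dist_pi_lt_iff hd] at hx
  have := hx l
  rw [Real.dist_eq, abs_lt] at this
  exact ⟨this.1.le, this.2⟩

lemma mem_closedBall_sub {P : (Fin n → ℝ) × ℝ} (h : 0 < P.2) (m : ℕ) (x : Fin n → ℝ) :
    x ∈ Metric.closedBall (dsub P m (idx P m x)).1 (dsub P m (idx P m x)).2 := by
  have hd : (0:ℝ) ≤ (dsub P m (idx P m x)).2 := by simp only [dsub]; positivity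
  rw [Metric.mem_closedBall, dist_pi_le_iff hd]
  intro l
  have := (idx_eq_iff h m x _).1 rfl l
  rw [Real.dist_eq, abs_le]
  exact ⟨this.1, this.2.le⟩

lemma idx_succ (P : (Fin n → ℝ) × ℝ) (m : ℕ) (x : Fin n → ℝ) :
    idx P m x = fun l => idx P (m + 1) x l / 2 := by
  ext l
  simp only [idx]
  have := Int.floor_div_natCast (2 ^ (m+1) * ((x l - P.1 l + P.2) / (2 * P.2))) 2
  push_cast at this
  rw [← this]
  congr 1
  rw [pow_succ]; ring

lemma idx_nested (P : (Fin n → ℝ) × ℝ) {m k : ℕ} (hmk : m ≤ k) {x y : Fin n → ℝ}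
    (hxy : idx P k x = idx P k y) : idx P m x = idx P m y := by
  induction k, hmk using Nat.le_induction with
  | base => exact hxy
  | succ k hk ih =>
    apply ih
    rw [idx_succ P k x, idx_succ P k y, hxy]

lemma dsub_pos {P : (Fin n → ℝ) × ℝ} (h : 0 < P.2) (m : ℕ) (i : Fin n → ℤ) :
    0 < (dsub P m i).2 := by simp only [dsub]; positivity

lemma dsub_zero_of_mem {P : (Fin n → ℝ) × ℝ} (h : 0 < P.2) {x : Fin n → ℝ} (hx : x ∈ bl P) :
    dsub P 0 (idx P 0 x) = P := by
  have e : dsub P 0 (fun _ => 0) = P := by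
    ext l <;> simp [dsub]
  have : idx P 0 x = fun _ => 0 := by
    apply idx_of_mem_bl h; rw [e]; exact hx
  rw [this, e]

lemma bl_dsub_subset {P : (Fin n → ℝ) × ℝ} (h : 0 < P.2) {m k : ℕ} (hmk : m ≤ k) (x : Fin n → ℝ) :
    bl (dsub P k (idx P k x)) ⊆ bl (dsub P m (idx P m x)) := by
  have h1 : bl (dsub P k (idx P k x)) ⊆
      Metric.closedBall (dsub P m (idx P m x)).1 (dsub P m (idx P m x)).2 := by
    intro y hy
    have := idx_nested P hmk (idx_of_mem_bl h hy)
    rw [← this]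
    exact mem_closedBall_sub h m y
  have := interior_maximal h1 (bl_isOpen _)
  rwa [interior_closedBall _ (dsub_pos h _ _).ne'] at this

lemma cz_step {σ : (Fin n → ℝ) → ℝ≥0∞} (hσ : Measurable σ) {P : (Fin n → ℝ) × ℝ} (h : 0 < P.2)
    (hfinI : ∫⁻ x in bl P, σ x ≠ ∞) {τ : ℝ≥0∞} (hτ : av σ P ≤ τ) :
    ∃ S : Set ((Fin n → ℝ) × ℝ), (∀ R ∈ S, 0 < R.2 ∧ bl R ⊆ bl P ∧ τ < av σ R ∧
        av σ R ≤ 2 ^ n * τ) ∧ S.PairwiseDisjoint bl ∧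
      ∀ᵐ x, x ∈ bl P → x ∉ ⋃ R ∈ S, bl R → σ x ≤ τ := by
  classical
  refine ⟨{R | ∃ m x, x ∈ bl P ∧ R = dsub P m (idx P m x) ∧ τ < av σ R ∧
    ∀ k < m, av σ (dsub P k (idx P k x)) ≤ τ}, ?_, ?_, ?_⟩
  · rintro R ⟨m, x, hx, rfl, h1, h2⟩
    have hm : m ≠ 0 := by
      rintro rfl
      rw [dsub_zero_of_mem h hx] at h1
      exact absurd hτ (not_le.2 h1)
    refine ⟨dsub_pos h _ _, ?_, h1, ?_⟩
    · have := bl_dsub_subset h (Nat.zero_le m) x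
      rwa [dsub_zero_of_mem h hx] at this
    · obtain ⟨k, rfl⟩ := Nat.exists_eq_succ_of_ne_zero hm
      have h3 := h2 k (Nat.lt_succ_self k)
      rw [av_le_iff (dsub_pos h _ _)] at h3 ⊢
      refine (lintegral_mono_set (bl_dsub_subset h (Nat.le_succ k) x)).trans (h3.trans ?_)
      rw [mul_comm (2 ^ n) τ, mul_assoc]
      gcongr
      rw [bl_vol (dsub_pos h _ _), bl_vol (dsub_pos h _ _)]
      rw [show (2 : ℝ≥0∞) ^ n = ENNReal.ofReal (2 ^ n) by
        rw [ENNReal.ofReal_pow (by norm_num)]; simp]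
      rw [← ENNReal.ofReal_mul (by positivity), ← mul_pow]
      apply le_of_eq
      congr 2
      simp only [dsub, Nat.succ_eq_add_one, pow_succ]
      field_simp
  · rintro R ⟨m, x, hx, rfl, h1, h2⟩ R' ⟨m', x', hx', rfl, h1', h2'⟩ hne
    rw [Function.onFun, Set.disjoint_left]
    intro y hy hy'
    have i1 := idx_of_mem_bl h hy
    have i2 := idx_of_mem_bl h hy'
    rcases lt_trichotomy m m' with hlt | rfl | hlt
    · have := h2' m hlt
      rw [← idx_nested P hlt.le i2, i1] at this
      exact absurd this (not_le.2 h1)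
    · exact hne (by rw [← i1, i2])
    · have := h2 m' hlt
      rw [← idx_nested P hlt.le i1, i2] at this
      exact absurd this (not_le.2 h1')
  · rcases eq_or_ne τ ∞ with rfl | hτt
    · simp
    have hfin : ∀ᵐ x, x ∈ bl P → σ x < ∞ := by
      rw [← ae_restrict_iff' (bl_meas P)]
      exact ae_lt_top hσ hfinI
    have hI : Integrable ((bl P).indicator fun x => (σ x).toReal) := by
      rw [integrable_indicator_iff (bl_meas P)]
      exact integrable_toReal_of_lintegral_ne_top hσ.aemeasurable hfinI
    have hdiff := IsUnifLocDoublingMeasure.ae_tendsto_average volume hI.locallyIntegrable 1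
    have hsph : ∀ᵐ x : Fin n → ℝ, ∀ m : ℕ, ∀ i : Fin n → ℤ,
        x ∉ Metric.sphere (dsub P m i).1 (dsub P m i).2 := by
      rw [ae_all_iff]; intro m
      rw [ae_all_iff]; intro i
      exact measure_eq_zero_iff_ae_notMem.1
        (Measure.addHaar_sphere_of_ne_zero volume _ (dsub_pos h m i).ne')
    filter_upwards [hfin, hdiff, hsph] with x hx1 hx2 hx3 hxP hxS
    have hall : ∀ m, av σ (dsub P m (idx P m x)) ≤ τ := by
      by_contra hcon
      push Not at hcon
      apply hxS
      refine mem_biUnion (x := dsub P (Nat.find hcon) (idx P (Nat.find hcon) x)) ?_ ?_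
      · refine ⟨Nat.find hcon, x, hxP, rfl, Nat.find_spec hcon, ?_⟩
        intro k hk
        exact not_lt.1 (Nat.find_min hcon hk)
      · have h1 := mem_closedBall_sub h (Nat.find hcon) x
        have h2 := hx3 (Nat.find hcon) (idx P (Nat.find hcon) x)
        rw [bl, Metric.mem_ball]
        rw [Metric.mem_closedBall] at h1
        rw [Metric.mem_sphere] at h2
        exact lt_of_le_of_ne h1 h2
    have hlim := @hx2 ℕ Filter.atTop (fun m => (dsub P m (idx P m x)).1) (fun m => P.2 / 2 ^ m) (by
      rw [tendsto_nhdsWithin_iff]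
      refine ⟨?_, Filter.Eventually.of_forall fun m => ?_⟩
      · have := (tendsto_pow_atTop_nhds_zero_of_lt_one (r := (1/2:ℝ)) (by norm_num) (by norm_num)).const_mul P.2
        simpa [div_eq_mul_inv] using this
      · have : 0 < P.2 / 2 ^ m := by positivity
        exact this) (Filter.Eventually.of_forall fun m => by
          rw [one_mul]; exact mem_closedBall_sub h m x)
    rw [indicator_of_mem hxP] at hlim
    have hle : (σ x).toReal ≤ τ.toReal := by
      refine le_of_tendsto' hlim fun m => ?_
      have hs := hall m
      set R := dsub P m (idx P m x) with hR
      have hRpos : 0 < R.2 := dsub_pos h _ _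
      have hsub : bl R ⊆ bl P := by
        have := bl_dsub_subset h (Nat.zero_le m) x
        rwa [dsub_zero_of_mem h hxP] at this
      have e0 : P.2 / 2 ^ m = R.2 := rfl
      rw [e0, setAverage_congr (bl_ae_closedBall hRpos).symm, setAverage_eq,
        setIntegral_congr_fun (g := fun x => (σ x).toReal) (bl_meas R)
          (fun y hy => indicator_of_mem (hsub hy) _),
        integral_toReal hσ.aemeasurable]
      · rw [measureReal_def, smul_eq_mul, inv_mul_eq_div, ← ENNReal.toReal_div]
        exact ENNReal.toReal_mono hτt hs
      · exact ae_lt_top hσ (ne_top_of_le_ne_top hfinI (lintegral_mono_set hsub))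
    exact (ENNReal.toReal_le_toReal (hx1 hxP).ne hτt).1 hle

end basics


section czi
variable {n : ℕ}

lemma cz_iter {σ : (Fin n → ℝ) → ℝ≥0∞} (hσ : Measurable σ) {P : (Fin n → ℝ) × ℝ} (h : 0 < P.2)
    (hfinI : ∫⁻ x in bl P, σ x ≠ ∞) (hU : av σ P ≠ 0) :
    ∃ F : ℕ → Set ((Fin n → ℝ) × ℝ), F 0 = {P} ∧ (∀ j, ∀ R ∈ F j, 0 < R.2) ∧
      (∀ j, (F j).PairwiseDisjoint bl) ∧ (∀ j, ∀ R ∈ F j, bl R ⊆ bl P) ∧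
      (∀ j, (⋃ R ∈ F (j + 1), bl R) ⊆ ⋃ R ∈ F j, bl R) ∧
      (∀ j, ∀ R ∈ F j, volume (bl R ∩ ⋃ R' ∈ F (j + 1), bl R') ≤ volume (bl R) / 2) ∧
      (∀ j, ∀ᵐ x, x ∈ bl P → x ∉ ⋃ R ∈ F j, bl R → σ x ≤ (2 ^ (n + 1)) ^ j * av σ P) := by
  classical
  set U := av σ P with hUdef
  have hUt : U ≠ ∞ := by
    rw [hUdef, av]; exact ENNReal.div_ne_top hfinI (bl_vol_ne_zero h)
  let Inv : ℕ → Set ((Fin n → ℝ) × ℝ) → Prop := fun j S =>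
    (∀ R ∈ S, 0 < R.2 ∧ bl R ⊆ bl P ∧ av σ R ≤ 2 ^ n * ((2 ^ (n + 1)) ^ j * U)) ∧
    S.PairwiseDisjoint bl ∧
    ∀ᵐ x, x ∈ bl P → x ∉ ⋃ R ∈ S, bl R → σ x ≤ (2 ^ (n + 1)) ^ j * U
  have step : ∀ j (S : {S // Inv j S}), ∃ S' : {S // Inv (j + 1) S},
      ((⋃ R ∈ S'.1, bl R) ⊆ ⋃ R ∈ S.1, bl R) ∧
      (∀ R ∈ S.1, volume (bl R ∩ ⋃ R' ∈ S'.1, bl R') ≤ volume (bl R) / 2) := by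
    rintro j ⟨S, hS1, hS2, hS3⟩
    set τ : ℝ≥0∞ := (2 ^ (n + 1)) ^ (j + 1) * U with hτ
    have hτ2 : τ = 2 * (2 ^ n * ((2 ^ (n + 1)) ^ j * U)) := by
      rw [hτ, pow_succ, pow_succ 2 n]; ring
    have hτ0 : τ ≠ 0 := by
      rw [hτ]; exact mul_ne_zero (by positivity) hU
    have hτt : τ ≠ ∞ := by
      rw [hτ]
      exact ENNReal.mul_ne_top (ENNReal.pow_ne_top (ENNReal.pow_ne_top (by simp))) hUt
    have hRint : ∀ R ∈ S, ∫⁻ x in bl R, σ x ≠ ∞ := fun R hR =>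
      ne_top_of_le_ne_top hfinI (lintegral_mono_set (hS1 R hR).2.1)
    have hle : ∀ R ∈ S, av σ R ≤ τ := fun R hR => by
      refine (hS1 R hR).2.2.trans ?_
      rw [hτ2, two_mul]; exact le_self_add
    have hex : ∀ R : (Fin n → ℝ) × ℝ, ∃ T : Set ((Fin n → ℝ) × ℝ), R ∈ S →
        (∀ R' ∈ T, 0 < R'.2 ∧ bl R' ⊆ bl R ∧ τ < av σ R' ∧ av σ R' ≤ 2 ^ n * τ) ∧
        T.PairwiseDisjoint bl ∧
        ∀ᵐ x, x ∈ bl R → x ∉ ⋃ R' ∈ T, bl R' → σ x ≤ τ := by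
      intro R
      by_cases hR : R ∈ S
      · obtain ⟨T, hT⟩ := cz_step hσ (hS1 R hR).1 (hRint R hR) (hle R hR)
        exact ⟨T, fun _ => hT⟩
      · exact ⟨∅, fun h => absurd h hR⟩
    choose T hT using hex
    have hScount : S.Countable := hS2.countable_of_isOpen (fun R _ => bl_isOpen R)
      (fun R hR => ⟨R.1, Metric.mem_ball_self (hS1 R hR).1⟩)
    refine ⟨⟨⋃ R ∈ S, T R, ?_, ?_, ?_⟩, ?_, ?_⟩
    · intro R' hR'
      rw [mem_iUnion₂] at hR'
      obtain ⟨R, hR, hR'⟩ := hR'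
      obtain ⟨h1, h2, h3, h4⟩ := (hT R hR).1 R' hR'
      exact ⟨h1, h2.trans (hS1 R hR).2.1, h4⟩
    · intro R1 hR1 R2 hR2 hne
      rw [mem_iUnion₂] at hR1 hR2
      obtain ⟨Q1, hQ1, hR1⟩ := hR1
      obtain ⟨Q2, hQ2, hR2⟩ := hR2
      by_cases hQ : Q1 = Q2
      · subst hQ
        exact (hT Q1 hQ1).2.1 hR1 hR2 hne
      · exact (hS2 hQ1 hQ2 hQ).mono ((hT Q1 hQ1).1 R1 hR1).2.1 ((hT Q2 hQ2).1 R2 hR2).2.1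
    · have hae : ∀ᵐ x, ∀ R ∈ S, x ∈ bl R → x ∉ ⋃ R' ∈ T R, bl R' → σ x ≤ τ := by
        rw [ae_ball_iff hScount]
        intro R hR
        exact (hT R hR).2.2
      filter_upwards [hS3, hae] with x hx1 hx2 hxP hxn
      by_cases hxS : x ∈ ⋃ R ∈ S, bl R
      · rw [mem_iUnion₂] at hxS
        obtain ⟨R, hR, hxR⟩ := hxS
        refine hx2 R hR hxR fun hc => hxn ?_
        rw [mem_iUnion₂] at hc ⊢
        obtain ⟨R', hR', hx'⟩ := hc
        exact ⟨R', mem_iUnion₂.2 ⟨R, hR, hR'⟩, hx'⟩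
      · refine (hx1 hxP hxS).trans ?_
        gcongr
        · exact one_le_pow₀ (by norm_num)
        · exact Nat.le_succ j
    · intro x hx
      rw [mem_iUnion₂] at hx ⊢
      obtain ⟨R', hR', hx⟩ := hx
      rw [mem_iUnion₂] at hR'
      obtain ⟨R, hR, hR'⟩ := hR'
      exact ⟨R, hR, ((hT R hR).1 R' hR').2.1 hx⟩
    · intro R hR
      have hsub : bl R ∩ ⋃ R' ∈ ⋃ R ∈ S, T R, bl R' ⊆ ⋃ R' ∈ T R, bl R' := by
        rintro x ⟨hxR, hx⟩
        rw [mem_iUnion₂] at hx ⊢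
        obtain ⟨R', hR', hx⟩ := hx
        rw [mem_iUnion₂] at hR'
        obtain ⟨Q, hQ, hR'⟩ := hR'
        have hQR : Q = R := by
          by_contra hne
          exact Set.disjoint_left.1 (hS2 hQ hR hne) (((hT Q hQ).1 R' hR').2.1 hx) hxR
        subst hQR
        exact ⟨R', hR', hx⟩
      refine (measure_mono hsub).trans ?_
      have hTc : (T R).Countable := (hT R hR).2.1.countable_of_isOpen (fun R _ => bl_isOpen R)
        (fun R' hR' => ⟨R'.1, Metric.mem_ball_self ((hT R hR).1 R' hR').1⟩)
      have h1 : τ * volume (⋃ R' ∈ T R, bl R') ≤ ∫⁻ x in bl R, σ x := by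
        calc τ * volume (⋃ R' ∈ T R, bl R')
            = ∑' R' : T R, τ * volume (bl R'.1) := by
              rw [measure_biUnion hTc (hT R hR).2.1 (fun R' _ => bl_meas R'), ENNReal.tsum_mul_left]
          _ ≤ ∑' R' : T R, ∫⁻ x in bl R'.1, σ x := by
              gcongr with R'
              have := (hT R hR).1 R'.1 R'.2
              exact (le_av_iff this.1).1 this.2.2.1.le
          _ = ∫⁻ x in ⋃ R' ∈ T R, bl R', σ x := by
              rw [lintegral_biUnion hTc (fun R' _ => bl_meas R') (hT R hR).2.1]
          _ ≤ _ := lintegral_mono_set (iUnion₂_subset fun R' hR' => ((hT R hR).1 R' hR').2.1)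
      have h2 : ∫⁻ x in bl R, σ x ≤ τ * (volume (bl R) / 2) := by
        refine ((av_le_iff (hS1 R hR).1).1 (hS1 R hR).2.2).trans (le_of_eq ?_)
        rw [hτ2, mul_comm 2, mul_assoc _ 2, ENNReal.mul_div_cancel (by simp) (by simp)]
      exact (ENNReal.mul_le_mul_iff_right hτ0 hτt).1 (h1.trans h2)
  have h0 : Inv 0 {P} := by
    refine ⟨?_, by simp, ?_⟩
    · intro R hR
      rw [mem_singleton_iff] at hR
      subst hR
      refine ⟨h, le_rfl, ?_⟩
      rw [pow_zero, one_mul]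
      exact le_mul_of_one_le_left (by simp) (one_le_pow₀ (by norm_num))
    · refine Filter.Eventually.of_forall fun x h1 h2 => absurd ?_ h2
      simpa using h1
  choose nxt hn1 hn2 using step
  let F : ∀ j, {S // Inv j S} := fun j => Nat.rec ⟨{P}, h0⟩ (fun j S => nxt j S) j
  have hF : ∀ j, F (j + 1) = nxt j (F j) := fun j => rfl
  refine ⟨fun j => (F j).1, rfl, fun j R hR => ((F j).2.1 R hR).1, fun j => (F j).2.2.1,
    fun j R hR => ((F j).2.1 R hR).2.1, fun j => ?_, fun j => ?_, fun j => (F j).2.2.2⟩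
  · exact hn1 j (F j)
  · exact hn2 j (F j)

end czi


section gl
variable {n : ℕ}

/-- gluing functions on sets -/
def gl {ι : Type*} (S : Finset ι) (A : ι → Set (Fin n → ℝ)) (u : ι → (Fin n → ℝ) → ℝ≥0∞)
    (x : Fin n → ℝ) : ℝ≥0∞ := ∑ P ∈ S, (A P).indicator (u P) x

variable {ι : Type*} {S : Finset ι} {A : ι → Set (Fin n → ℝ)} {u : ι → (Fin n → ℝ) → ℝ≥0∞}

lemma gl_of_mem (hd : (S : Set ι).PairwiseDisjoint A) {P : ι} (hP : P ∈ S) {x : Fin n → ℝ}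
    (hx : x ∈ A P) : gl S A u x = u P x := by
  rw [gl, Finset.sum_eq_single P, indicator_of_mem hx]
  · intro Q hQ hne
    exact indicator_of_notMem (fun hxQ => (hd hQ hP hne).le_bot ⟨hxQ, hx⟩) _
  · exact fun h => absurd hP h

lemma gl_of_notMem {x : Fin n → ℝ} (hx : ∀ P ∈ S, x ∉ A P) : gl S A u x = 0 := by
  rw [gl]
  exact Finset.sum_eq_zero fun P hP => indicator_of_notMem (hx P hP) _

lemma gl_rpow (hd : (S : Set ι).PairwiseDisjoint A) (x : Fin n → ℝ) {y : ℝ} (hy : 0 < y) 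
    {v : ι → (Fin n → ℝ) → ℝ≥0∞} (hv : ∀ P ∈ S, x ∈ A P → v P x = u P x ^ y) :
    gl S A u x ^ y = gl S A v x := by
  by_cases h : ∃ P ∈ S, x ∈ A P
  · obtain ⟨P, hP, hx⟩ := h
    rw [gl_of_mem hd hP hx, gl_of_mem hd hP hx, hv P hP hx]
  · push Not at h
    rw [gl_of_notMem h, gl_of_notMem h, ENNReal.zero_rpow_of_pos hy]

lemma gl_measurable (hA : ∀ P ∈ S, MeasurableSet (A P)) (hu : ∀ P ∈ S, Measurable (u P)) :
    Measurable (gl S A u) := by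
  unfold gl
  exact Finset.measurable_sum _ fun P hP => (hu P hP).indicator (hA P hP)

lemma lintegral_gl (hA : ∀ P ∈ S, MeasurableSet (A P)) (hu : ∀ P ∈ S, Measurable (u P)) :
    ∫⁻ x, gl S A u x = ∑ P ∈ S, ∫⁻ x in A P, u P x := by
  simp only [gl]
  rw [lintegral_finsetSum _ fun P hP => (hu P hP).indicator (hA P hP)]
  exact Finset.sum_congr rfl fun P hP => lintegral_indicator (hA P hP) _

lemma lintegral_gl_rpow (hd : (S : Set ι).PairwiseDisjoint A) (hA : ∀ P ∈ S, MeasurableSet (A P))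
    (hu : ∀ P ∈ S, Measurable (u P)) {e : (Fin n → ℝ) → ℝ} (he : Measurable e)
    (hpos : ∀ x, 0 < e x) :
    ∫⁻ x, gl S A u x ^ e x = ∑ P ∈ S, ∫⁻ x in A P, u P x ^ e x := by
  rw [← lintegral_gl (u := fun P x => u P x ^ e x) hA (fun P hP => (hu P hP).pow he)]
  exact lintegral_congr fun x => gl_rpow hd x (hpos x) fun P _ _ => rfl

lemma av_gl (hd : (S : Set ι).PairwiseDisjoint A) {P : ι} (hP : P ∈ S) {R : (Fin n → ℝ) × ℝ}
    (hR : bl R ⊆ A P) : av (gl S A u) R = av (u P) R := by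
  unfold av
  congr 1
  exact setLIntegral_congr_fun (bl_meas R) fun x hx => gl_of_mem hd hP (hR hx)

/-- modular version of condition A for open cubes -/
def Amod (e : (Fin n → ℝ) → ℝ) (C : ℝ≥0∞) : Prop :=
  ∀ S : Finset ((Fin n → ℝ) × ℝ), (∀ P ∈ S, 0 < P.2) →
    (S : Set ((Fin n → ℝ) × ℝ)).PairwiseDisjoint bl →
    ∀ f : (Fin n → ℝ) → ℝ≥0∞, Measurable f → ∫⁻ x, f x ^ e x ≤ 1 →
      ∑ P ∈ S, ∫⁻ x in bl P, (av f P / C) ^ e x ≤ 1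

lemma tsum_le_of_finset {α : Type*} {G : Set α} {g : α → ℝ≥0∞} {K : ℝ≥0∞}
    (h : ∀ S : Finset α, (S : Set α) ⊆ G → ∑ R ∈ S, g R ≤ K) : ∑' R : G, g R ≤ K := by
  classical
  rw [ENNReal.tsum_eq_iSup_sum]
  refine iSup_le fun s => ?_
  have := h (s.map (Function.Embedding.subtype _)) (by intro x; simp; tauto)
  simpa using this

lemma AmodS {e : (Fin n → ℝ) → ℝ} {C : ℝ≥0∞} (h : Amod e C) {G : Set ((Fin n → ℝ) × ℝ)}
    (hG : ∀ P ∈ G, 0 < P.2) (hd : G.PairwiseDisjoint bl) {f : (Fin n → ℝ) → ℝ≥0∞}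
    (hf : Measurable f) (hf1 : ∫⁻ x, f x ^ e x ≤ 1) :
    ∑' P : G, ∫⁻ x in bl P.1, (av f P.1 / C) ^ e x ≤ 1 :=
  tsum_le_of_finset (g := fun P => ∫⁻ x in bl P, (av f P / C) ^ e x)
    fun S hS => h S (fun P hP => hG P (hS hP)) (hd.subset hS) f hf hf1

lemma rpow_mono_base {a b : ℝ≥0∞} (h : a ≤ b) {y : ℝ} (hy : 0 < y) : a ^ y ≤ b ^ y :=
  ENNReal.rpow_le_rpow h hy.le

lemma ainf {e : (Fin n → ℝ) → ℝ} {C : ℝ≥0∞} (h : Amod e C) (he : Measurable e)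
    (hpos : ∀ x, 0 < e x)
    {S : Finset ((Fin n → ℝ) × ℝ)} (hd : (S : Set ((Fin n → ℝ) × ℝ)).PairwiseDisjoint bl)
    {Fm : (Fin n → ℝ) × ℝ → Set ((Fin n → ℝ) × ℝ)}
    (h1 : ∀ P ∈ S, ∀ R ∈ Fm P, 0 < R.2) (h2 : ∀ P ∈ S, (Fm P).PairwiseDisjoint bl)
    (h3 : ∀ P ∈ S, ∀ R ∈ Fm P, bl R ⊆ bl P)
    {D' : (Fin n → ℝ) × ℝ → Set (Fin n → ℝ)} (hD' : ∀ P ∈ S, MeasurableSet (D' P))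
    (h4 : ∀ P ∈ S, ∀ R ∈ Fm P, volume (bl R ∩ D' P) ≤ volume (bl R) / 2)
    {u : (Fin n → ℝ) × ℝ → ℝ≥0∞}
    (hu : ∑ P ∈ S, ∫⁻ x in (⋃ R ∈ Fm P, bl R) \ D' P, u P ^ e x ≤ 1) :
    ∑ P ∈ S, ∫⁻ x in ⋃ R ∈ Fm P, bl R, (u P / (2 * C)) ^ e x ≤ 1 := by
  classical
  set A : (Fin n → ℝ) × ℝ → Set (Fin n → ℝ) := fun P => (⋃ R ∈ Fm P, bl R) \ D' P with hA
  have hAd : (S : Set ((Fin n → ℝ) × ℝ)).PairwiseDisjoint A := by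
    refine hd.mono_on fun P hP => ?_
    exact sdiff_subset.trans (iUnion₂_subset (h3 P hP))
  have hAm : ∀ P ∈ S, MeasurableSet (A P) := fun P hP =>
    (isOpen_biUnion fun R _ => bl_isOpen R).measurableSet.diff (hD' P hP)
  set f := gl S A (fun P _ => u P) with hf
  have hfm : Measurable f := gl_measurable hAm fun P _ => measurable_const
  have hf1 : ∫⁻ x, f x ^ e x ≤ 1 := by
    rw [hf, lintegral_gl_rpow hAd hAm (fun P _ => measurable_const) he hpos]; exact hu
  have hav : ∀ P ∈ S, ∀ R ∈ Fm P, u P / 2 ≤ av f R := by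
    intro P hP R hR
    rw [le_av_iff (h1 P hP R hR)]
    have hv : volume (bl R) / 2 ≤ volume (bl R \ D' P) := by
      have := measure_inter_add_sdiff₀ (μ := volume) (bl R) (hD' P hP).nullMeasurableSet
      have h5 := h4 P hP R hR
      have h6 : volume (bl R) / 2 + volume (bl R) / 2 ≤ volume (bl R) / 2 + volume (bl R \ D' P) := by
        rw [ENNReal.add_halves, ← this]; gcongr; rwa [this]
      exact (ENNReal.add_le_add_iff_left
        (ENNReal.div_ne_top (bl_vol_ne_top R) (by simp))).1 h6
    calc u P / 2 * volume (bl R) = u P * (volume (bl R) / 2) := by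
          rw [div_eq_mul_inv, div_eq_mul_inv]; ring
      _ ≤ u P * volume (bl R \ D' P) := by gcongr
      _ = ∫⁻ x in bl R \ D' P, u P := by rw [setLIntegral_const]
      _ = ∫⁻ x in bl R \ D' P, f x := by
          refine setLIntegral_congr_fun ((bl_meas R).diff (hD' P hP)) fun x hx => ?_
          exact (gl_of_mem (u := fun P _ => u P) hAd hP ⟨mem_biUnion hR hx.1, hx.2⟩).symm
      _ ≤ _ := lintegral_mono_set sdiff_subset
  have hPd : (S : Set ((Fin n → ℝ) × ℝ)).PairwiseDisjoint Fm := by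
    intro P hP Q hQ hne
    refine Set.disjoint_left.2 fun R hR hR' => ?_
    have : R.1 ∈ bl R := Metric.mem_ball_self (h1 P hP R hR)
    exact (hd hP hQ hne).le_bot ⟨h3 P hP R hR this, h3 Q hQ R hR' this⟩
  have key := AmodS h (G := ⋃ P ∈ (S : Set ((Fin n → ℝ) × ℝ)), Fm P) ?_ ?_ hfm hf1
  · rw [ENNReal.tsum_biUnion' (f := fun P => ∫⁻ x in bl P, (av f P / C) ^ e x) hPd] at key
    refine le_trans ?_ key
    rw [Finset.tsum_subtype' S (fun P => ∑' R : Fm P, ∫⁻ x in bl R.1, (av f R.1 / C) ^ e x)]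
    refine Finset.sum_le_sum fun P hP => ?_
    have hc : (Fm P).Countable := (h2 P hP).countable_of_isOpen (fun R _ => bl_isOpen R)
        (fun R hR => ⟨R.1, Metric.mem_ball_self (h1 P hP R hR)⟩)
    rw [lintegral_biUnion hc (fun R _ => bl_meas R) (h2 P hP)]
    refine ENNReal.tsum_le_tsum fun R => ?_
    refine lintegral_mono fun x => rpow_mono_base ?_ (hpos x)
    rw [ENNReal.div_eq_inv_mul (b := 2 * C), ENNReal.mul_inv (by simp) (by simp), mul_comm (2⁻¹), mul_assoc,
      ← ENNReal.div_eq_inv_mul (b := C)]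
    gcongr
    rw [← ENNReal.div_eq_inv_mul]
    exact hav P hP R.1 R.2
  · simp only [mem_iUnion]
    rintro R ⟨P, hP, hR⟩
    exact h1 P hP R hR
  · intro R hR R' hR' hne
    simp only [mem_iUnion] at hR hR'
    obtain ⟨P, hP, hR⟩ := hR
    obtain ⟨Q, hQ, hR'⟩ := hR'
    by_cases hPQ : P = Q
    · subst hPQ
      exact h2 P hP hR hR' hne
    · exact (hd hP hQ hPQ).mono (h3 P hP R hR) (h3 Q hQ R' hR')

end gl


section rh
variable {n : ℕ}

lemma rpow_mul_ge {c v : ℝ≥0∞} (hc : 1 ≤ c) {y : ℝ} (hy : 1 ≤ y) : c * v ^ y ≤ (c * v) ^ y := by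
  rw [ENNReal.mul_rpow_of_nonneg _ _ (by linarith)]
  gcongr
  calc c = c ^ (1:ℝ) := by simp
    _ ≤ c ^ y := ENNReal.rpow_le_rpow_of_exponent_le hc hy

lemma rpow_mul_le {c v : ℝ≥0∞} (hc : 1 ≤ c) {y B : ℝ} (hy : 1 ≤ y) (hB : y ≤ B) :
    (c * v) ^ y ≤ c ^ B * v ^ y := by
  rw [ENNReal.mul_rpow_of_nonneg _ _ (by linarith)]
  gcongr

lemma av_pow_ne {e : (Fin n → ℝ) → ℝ} {B : ℝ}
    (h1 : ∀ x, 1 ≤ e x) (hB : ∀ x, e x ≤ B) {P : (Fin n → ℝ) × ℝ} (hP : 0 < P.2) {u : ℝ≥0∞}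
    (h0 : u ≠ 0) (ht : u ≠ ∞) : av (fun x => u ^ e x) P ≠ 0 ∧ av (fun x => u ^ e x) P ≠ ∞ := by
  obtain ⟨l, rfl⟩ := ee_surj h0 ht
  have ha : ∀ x, |l * e x| ≤ |l| * B := fun x => by
    rw [abs_mul, abs_of_nonneg (by linarith [h1 x] : 0 ≤ e x)]
    exact mul_le_mul_of_nonneg_left (hB x) (abs_nonneg l)
  constructor
  · have : ee (-(|l| * B)) ≤ av (fun x => ee l ^ e x) P := by
      rw [← av_const (ee (-(|l| * B))) hP]
      refine av_mono P fun x => ?_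
      rw [ee_rpow, ee_le]; exact (abs_le.1 (ha x)).1
    exact ((ee_pos _).trans_le this).ne'
  · have : av (fun x => ee l ^ e x) P ≤ ee (|l| * B) := by
      rw [← av_const (ee (|l| * B)) hP]
      refine av_mono P fun x => ?_
      rw [ee_rpow, ee_le]; exact (abs_le.1 (ha x)).2
    exact ne_top_of_le_ne_top (ee_ne_top _) this

lemma decay {e : (Fin n → ℝ) → ℝ} {C : ℝ≥0∞} {B : ℝ} (h : Amod e C) (he : Measurable e)
    (he1 : ∀ x, 1 ≤ e x) (heB : ∀ x, e x ≤ B) (hC1 : 1 ≤ C) (hC : C ≠ ∞)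
    {S : Finset ((Fin n → ℝ) × ℝ)} (hd : (S : Set ((Fin n → ℝ) × ℝ)).PairwiseDisjoint bl)
    {Fm : (Fin n → ℝ) × ℝ → Set ((Fin n → ℝ) × ℝ)}
    (h1 : ∀ P ∈ S, ∀ R ∈ Fm P, 0 < R.2) (h2 : ∀ P ∈ S, (Fm P).PairwiseDisjoint bl)
    (h3 : ∀ P ∈ S, ∀ R ∈ Fm P, bl R ⊆ bl P)
    {D' : (Fin n → ℝ) × ℝ → Set (Fin n → ℝ)} (hD' : ∀ P ∈ S, MeasurableSet (D' P))
    (hsub : ∀ P ∈ S, D' P ⊆ ⋃ R ∈ Fm P, bl R)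
    (h4 : ∀ P ∈ S, ∀ R ∈ Fm P, volume (bl R ∩ D' P) ≤ volume (bl R) / 2)
    {u : (Fin n → ℝ) × ℝ → ℝ≥0∞}
    (hu : ∑ P ∈ S, ∫⁻ x in ⋃ R ∈ Fm P, bl R, u P ^ e x ≤ 1) :
    (∑ P ∈ S, ∫⁻ x in D' P, u P ^ e x) + ((8 * C) ^ B)⁻¹ ≤ 1 := by
  classical
  have hB1 : 1 ≤ B := (he1 0).trans (heB 0)
  have h8 : (8:ℝ≥0∞) ≤ 8 * C := le_mul_of_one_le_right (by simp) hC1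
  have h81 : (1:ℝ≥0∞) ≤ 8 * C := le_trans (by norm_num) h8
  have h8t : (8 * C) ^ B ≠ ∞ := ENNReal.rpow_ne_top_of_nonneg (by linarith)
    (ENNReal.mul_ne_top (by simp) hC)
  have h8p : (8:ℝ≥0∞) ≤ (8 * C) ^ B :=
    calc (8:ℝ≥0∞) ≤ (8 * C) ^ (1:ℝ) := by simpa using h8
      _ ≤ _ := ENNReal.rpow_le_rpow_of_exponent_le h81 hB1
  have h80 : (8 * C) ^ B ≠ 0 := fun h0 => by rw [h0] at h8p; simp at h8p
  have hsplit : ∑ P ∈ S, ∫⁻ x in ⋃ R ∈ Fm P, bl R, u P ^ e x =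
      (∑ P ∈ S, ∫⁻ x in D' P, u P ^ e x) + ∑ P ∈ S, ∫⁻ x in (⋃ R ∈ Fm P, bl R) \ D' P, u P ^ e x := by
    rw [← Finset.sum_add_distrib]
    refine Finset.sum_congr rfl fun P hP => ?_
    rw [← lintegral_inter_add_sdiff (μ := volume) (fun x => u P ^ e x) (⋃ R ∈ Fm P, bl R) (hD' P hP),
      inter_eq_self_of_subset_right (hsub P hP)]
  set a := ∑ P ∈ S, ∫⁻ x in D' P, u P ^ e x with ha
  set b := ∑ P ∈ S, ∫⁻ x in (⋃ R ∈ Fm P, bl R) \ D' P, u P ^ e x with hb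
  rcases le_or_gt a (1/2) with hcase | hcase
  · calc a + ((8 * C) ^ B)⁻¹ ≤ 1/2 + 1/2 := by
          gcongr
          rw [one_div]
          exact ENNReal.inv_le_inv.2 (le_trans (by norm_num) h8p)
      _ = 1 := ENNReal.add_halves 1
  · have hlt : 1 < (8 * C) ^ B * b := by
      by_contra hcon
      push Not at hcon
      have := ainf h he (fun x => by linarith [he1 x]) hd h1 h2 h3 hD' h4
        (u := fun P => 8 * C * u P) (le_trans ?_ hcon)
      · have h5 : 4 * ∑ P ∈ S, ∫⁻ x in ⋃ R ∈ Fm P, bl R, u P ^ e x ≤ 1 := by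
          refine le_trans ?_ this
          rw [Finset.mul_sum]
          refine Finset.sum_le_sum fun P hP => ?_
          rw [← lintegral_const_mul' _ _ (by simp)]
          refine lintegral_mono fun x => ?_
          have h6 : 8 * C * u P / (2 * C) = 4 * u P := by
            rw [show 8 * C * u P = (4 * u P) * (2 * C) by ring]
            exact ENNReal.mul_div_cancel_right (by simp; rintro rfl; simp at hC1)
              (ENNReal.mul_ne_top (by simp) hC)
          rw [h6]
          exact rpow_mul_ge (by norm_num) (he1 x)
        rw [hsplit] at h5
        have h7 : (4:ℝ≥0∞) * (1/2) < 4 * (a + b) := by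
          refine (ENNReal.mul_lt_mul_iff_right (by simp) (by simp)).2 (hcase.trans_le le_self_add)
        have h8 : (4:ℝ≥0∞) * (1/2) = 2 := by
          rw [show (4:ℝ≥0∞) = 2 * 2 by norm_num, one_div, mul_assoc, ENNReal.mul_inv_cancel (by simp) (by simp), mul_one]
        rw [h8] at h7
        exact absurd (h7.trans_le h5) (by norm_num)
      · rw [hb, Finset.mul_sum]
        refine Finset.sum_le_sum fun P hP => ?_
        rw [← lintegral_const_mul' _ _ h8t]
        exact lintegral_mono fun x => rpow_mul_le h81 (he1 x) (heB x)
    have : ((8 * C) ^ B)⁻¹ ≤ b := by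
      rw [ENNReal.inv_le_iff_le_mul (fun _ => h80) (fun h => absurd h h8t)]
      exact hlt.le
    calc a + ((8 * C) ^ B)⁻¹ ≤ a + b := by gcongr
      _ ≤ 1 := hsplit ▸ hu

lemma RH {e : (Fin n → ℝ) → ℝ} {C : ℝ≥0∞} {B : ℝ} (h : Amod e C) (he : Measurable e)
    (he1 : ∀ x, 1 ≤ e x) (heB : ∀ x, e x ≤ B) (hC1 : 1 ≤ C) (hC : C ≠ ∞) :
    ∃ r0 : ℝ, 1 < r0 ∧ ∃ K : ℝ≥0∞, K ≠ ∞ ∧ ∀ r : ℝ, 1 ≤ r → r ≤ r0 →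
      ∀ S : Finset ((Fin n → ℝ) × ℝ), (∀ P ∈ S, 0 < P.2) →
      (S : Set ((Fin n → ℝ) × ℝ)).PairwiseDisjoint bl → ∀ u : (Fin n → ℝ) × ℝ → ℝ≥0∞,
      (∀ P ∈ S, u P ≠ 0 ∧ u P ≠ ∞) → ∑ P ∈ S, ∫⁻ x in bl P, u P ^ e x ≤ 1 →
      ∑ P ∈ S, ∫⁻ x in bl P,
        u P ^ e x * (u P ^ e x / av (fun x => u P ^ e x) P) ^ (r - 1) ≤ K := by
  classical
  have hB1 : 1 ≤ B := (he1 0).trans (heB 0)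
  have h8t : (8 * C) ^ B ≠ ∞ := ENNReal.rpow_ne_top_of_nonneg (by linarith)
    (ENNReal.mul_ne_top (by simp) hC)
  have h80 : 8 * C ≠ 0 := by simp; rintro rfl; simp at hC1
  have h80' : (8 * C) ^ B ≠ 0 := by
    simp only [ne_eq, ENNReal.rpow_eq_zero_iff, not_or]
    refine ⟨fun hh => h80 hh.1, fun hh => ENNReal.mul_ne_top (by simp) hC hh.1⟩
  obtain ⟨xx, hxx⟩ := ee_surj (a := 1 + ((8 * C) ^ B)⁻¹) (by simp) (by simp [h80'])
  have hxx0 : 0 < xx := by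
    rw [← ee_lt, ee_zero, ← hxx]
    exact ENNReal.lt_add_right (by simp) (by simp [h8t])
  obtain ⟨β, hβ⟩ := ee_surj (a := (2:ℝ≥0∞) ^ (n + 1)) (by simp) (by simp)
  have hβ0 : 0 < β := by
    rw [← ee_lt, ee_zero, ← hβ]
    exact one_lt_pow₀ (by norm_num) (by simp)
  set η := xx / B with hη
  have hη0 : 0 < η := by positivity
  have hηB : η * B = xx := by rw [hη]; field_simp
  refine ⟨1 + η / (2 * β), by have : 0 < η / (2 * β) := by positivity
                              linarith, ee (η / 2) * (1 - ee (-(η / 2)))⁻¹, ?_, ?_⟩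
  · refine ENNReal.mul_ne_top (ee_ne_top _) (ENNReal.inv_ne_top.2 ?_)
    have : ee (-(η/2)) < 1 := by rw [← ee_zero, ee_lt]; linarith
    exact (tsub_pos_of_lt this).ne'
  intro r hr1 hr S hSpos hd u hu hu1
  have hU : ∀ P ∈ S, av (fun x => u P ^ e x) P ≠ 0 ∧ av (fun x => u P ^ e x) P ≠ ∞ :=
    fun P hP => av_pow_ne he1 heB (hSpos P hP) (hu P hP).1 (hu P hP).2
  have cz : ∀ P : {P // P ∈ S}, _ := fun P => cz_iter (σ := fun x => u P.1 ^ e x)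
    (measurable_const.pow he) (hSpos P.1 P.2)
    (by rw [← vol_mul_av _ (hSpos P.1 P.2)]
        exact ENNReal.mul_ne_top (bl_vol_ne_top _) (hU P.1 P.2).2) (hU P.1 P.2).1
  choose F0 c0 c1 c2 c3 c4 c5 c6 using cz
  let Fm : ℕ → (Fin n → ℝ) × ℝ → Set ((Fin n → ℝ) × ℝ) :=
    fun j P => if hP : P ∈ S then F0 ⟨P, hP⟩ j else ∅
  have hFm : ∀ j P (hP : P ∈ S), Fm j P = F0 ⟨P, hP⟩ j := fun j P hP => dif_pos hP
  let D : ℕ → (Fin n → ℝ) × ℝ → Set (Fin n → ℝ) := fun j P => ⋃ R ∈ Fm j P, bl R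
  have hDm : ∀ j P, MeasurableSet (D j P) := fun j P =>
    (isOpen_biUnion fun R _ => bl_isOpen R).measurableSet
  have hD0 : ∀ P ∈ S, D 0 P = bl P := fun P hP => by
    simp only [D, hFm 0 P hP, c0 ⟨P, hP⟩]; simp
  have hDsub : ∀ j, ∀ P ∈ S, D j P ⊆ bl P := fun j P hP => by
    simp only [D, hFm j P hP]; exact iUnion₂_subset (c3 ⟨P, hP⟩ j)
  have hR : ∀ j : ℕ, ∑ P ∈ S, ∫⁻ x in D j P, (ee (η * j) * u P) ^ e x ≤ 1 := by
    intro j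
    induction j with
    | zero =>
      simp only [Nat.cast_zero, mul_zero, ee_zero, one_mul]
      refine le_trans (le_of_eq (Finset.sum_congr rfl fun P hP => ?_)) hu1
      rw [hD0 P hP]
    | succ j ih =>
      have hdec := decay h he he1 heB hC1 hC hd (Fm := Fm j) (D' := D (j + 1))
        (fun P hP => by rw [hFm j P hP]; exact c1 ⟨P, hP⟩ j)
        (fun P hP => by rw [hFm j P hP]; exact c2 ⟨P, hP⟩ j)
        (fun P hP => by rw [hFm j P hP]; exact c3 ⟨P, hP⟩ j)
        (fun P _ => hDm _ P)
        (fun P hP => by simp only [D]; rw [hFm j P hP, hFm (j+1) P hP]; exact c4 ⟨P, hP⟩ j)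
        (fun P hP => by simp only [D]; rw [hFm j P hP, hFm (j+1) P hP]; exact c5 ⟨P, hP⟩ j)
        (u := fun P => ee (η * j) * u P) ih
      set a := ∑ P ∈ S, ∫⁻ x in D (j+1) P, (ee (η * j) * u P) ^ e x with ha
      have ha1 : a ≤ 1 := le_trans le_self_add hdec
      calc ∑ P ∈ S, ∫⁻ x in D (j+1) P, (ee (η * (j+1 : ℕ)) * u P) ^ e x
          ≤ (1 + ((8 * C) ^ B)⁻¹) * a := by
            rw [ha, Finset.mul_sum]
            refine Finset.sum_le_sum fun P hP => ?_
            rw [← lintegral_const_mul' _ _ (by rw [hxx]; exact ee_ne_top _)]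
            refine lintegral_mono fun x => ?_
            have : ee (η * (j+1 : ℕ)) * u P = ee η * (ee (η * j) * u P) := by
              rw [← mul_assoc, ← ee_add]; congr 2; push_cast; ring
            rw [this, hxx, ← hηB, ← ee_rpow η B]
            refine rpow_mul_le ?_ (he1 x) (heB x)
            rw [← ee_zero, ee_le]; exact hη0.le
        _ = a + ((8 * C) ^ B)⁻¹ * a := by ring
        _ ≤ a + ((8 * C) ^ B)⁻¹ := by gcongr; exact mul_le_of_le_one_right' ha1
        _ ≤ 1 := hdec
  have hR' : ∀ j : ℕ, ∑ P ∈ S, ∫⁻ x in D j P, u P ^ e x ≤ ee (-(η * j)) := by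
    intro j
    rw [ee_neg, ENNReal.le_inv_iff_mul_le, mul_comm]
    refine le_trans ?_ (hR j)
    rw [Finset.mul_sum]
    refine Finset.sum_le_sum fun P hP => ?_
    rw [← lintegral_const_mul' _ _ (ee_ne_top _)]
    refine lintegral_mono fun x => rpow_mul_ge ?_ (he1 x)
    rw [← ee_zero, ee_le]; positivity
  have hpt : ∀ P ∈ S, ∀ᵐ x, x ∈ bl P →
      u P ^ e x * (u P ^ e x / av (fun x => u P ^ e x) P) ^ (r - 1) ≤
      ∑' j : ℕ, (D j P).indicator (fun x => u P ^ e x * ee (β * (j+1) * (r-1))) x := by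
    intro P hP
    have hall := ae_all_iff.2 (fun j => c6 ⟨P, hP⟩ j)
    filter_upwards [hall] with x hx hxP
    have hσ0 : u P ^ e x ≠ 0 := by
      simp only [ne_eq, ENNReal.rpow_eq_zero_iff, not_or]
      exact ⟨fun hh => (hu P hP).1 hh.1, fun hh => (hu P hP).2 hh.1⟩
    by_cases hex : ∃ j, x ∉ D j P
    · obtain ⟨m, hm, hmin⟩ : ∃ m, x ∉ D m P ∧ ∀ k < m, x ∈ D k P :=
        ⟨Nat.find hex, Nat.find_spec hex, fun k hk => not_not.1 (Nat.find_min hex hk)⟩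
      have hm0 : m ≠ 0 := by rintro rfl; rw [hD0 P hP] at hm; exact hm hxP
      obtain ⟨j, rfl⟩ := Nat.exists_eq_succ_of_ne_zero hm0
      refine le_trans ?_ (ENNReal.le_tsum j)
      rw [indicator_of_mem (hmin j (Nat.lt_succ_self j))]
      gcongr
      have h1 := hx (j+1) hxP (by simpa only [D, hFm (j+1) P hP] using hm)
      rw [← ee_rpow]
      refine ENNReal.rpow_le_rpow ?_ (by linarith)
      refine ENNReal.div_le_of_le_mul (h1.trans (le_of_eq ?_))
      congr 1
      rw [hβ, ← ENNReal.rpow_natCast, ee_rpow]; push_cast; rfl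
    · push Not at hex
      refine le_trans le_top (le_of_eq ?_)
      symm
      rw [eq_top_iff]
      calc (⊤:ℝ≥0∞) = ∑' j : ℕ, u P ^ e x := (ENNReal.tsum_const_eq_top_of_ne_zero hσ0).symm
        _ ≤ _ := by
          refine ENNReal.tsum_le_tsum fun j => ?_
          rw [indicator_of_mem (hex j)]
          refine le_mul_of_one_le_right (by simp) ?_
          rw [← ee_zero, ee_le]
          have : 0 ≤ r - 1 := by linarith
          positivity
  calc ∑ P ∈ S, ∫⁻ x in bl P,
        u P ^ e x * (u P ^ e x / av (fun x => u P ^ e x) P) ^ (r - 1)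
      ≤ ∑ P ∈ S, ∫⁻ x in bl P, ∑' j : ℕ,
          (D j P).indicator (fun x => u P ^ e x * ee (β * (j+1) * (r-1))) x := by
        refine Finset.sum_le_sum fun P hP => ?_
        exact setLIntegral_mono_ae' (bl_meas P) (hpt P hP)
    _ = ∑ P ∈ S, ∑' j : ℕ, ee (β * (j+1) * (r-1)) * ∫⁻ x in D j P, u P ^ e x := by
        refine Finset.sum_congr rfl fun P hP => ?_
        have hmm : ∀ j : ℕ, Measurable (fun x => u P ^ e x * ee (β * (j+1) * (r-1))) :=
          fun j => (measurable_const.pow he).mul measurable_const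
        rw [lintegral_tsum fun j => ((hmm j).indicator (hDm j P)).aemeasurable]
        refine tsum_congr fun j => ?_
        rw [lintegral_indicator (hDm j P), Measure.restrict_restrict (hDm j P),
          inter_eq_self_of_subset_left (hDsub j P hP), lintegral_mul_const' _ _ (ee_ne_top _), mul_comm]
    _ = ∑' j : ℕ, ee (β * (j+1) * (r-1)) * ∑ P ∈ S, ∫⁻ x in D j P, u P ^ e x := by
        rw [← Summable.tsum_finsetSum (fun _ _ => ENNReal.summable)]
        simp_rw [Finset.mul_sum]
    _ ≤ ∑' j : ℕ, ee (η / 2) * ee (-(η / 2)) ^ j := by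
        refine ENNReal.tsum_le_tsum fun j => ?_
        refine (mul_le_mul' le_rfl (hR' j)).trans ?_
        rw [← ENNReal.rpow_natCast, ee_rpow, ← ee_add, ← ee_add, ee_le]
        have h3 : β * (r - 1) ≤ η / 2 := by
          have : r - 1 ≤ η / (2 * β) := by linarith
          calc β * (r-1) ≤ β * (η / (2 * β)) := by gcongr
            _ = η / 2 := by field_simp
        have h4 : (0:ℝ) ≤ (j:ℝ) + 1 := by positivity
        nlinarith [mul_le_mul_of_nonneg_left h3 h4]
    _ = ee (η / 2) * (1 - ee (-(η / 2)))⁻¹ := by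
        rw [ENNReal.tsum_mul_left, ENNReal.tsum_geometric]

end rh


section fam
variable {n : ℕ}

lemma gap_up {R : ℕ → ℝ≥0∞} (h0 : R 0 ≤ 1) (h1 : ∀ k, R (k + 1) ≤ 2 * R k)
    (h2 : ∀ k, R k ≤ 1 → R k ≤ 1 / 2) (k : ℕ) : R k ≤ 1 / 2 := by
  induction k with
  | zero => exact h2 0 h0
  | succ k ih =>
    refine h2 _ ((h1 k).trans ?_)
    calc 2 * R k ≤ 2 * (1 / 2) := by gcongr
      _ = 1 := by rw [one_div]; exact ENNReal.mul_inv_cancel (by simp) (by simp)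

lemma gap_down {R : ℕ → ℝ≥0∞} (h1 : ∀ k, R k ≤ 2 * R (k + 1))
    (h2 : ∀ k, R k ≤ 1 → R k ≤ 1 / 2) {N : ℕ} (h0 : R N ≤ 1) : R 0 ≤ 1 / 2 := by
  induction N with
  | zero => exact h2 0 h0
  | succ k ih =>
    refine ih ((h1 k).trans ?_)
    calc 2 * R (k + 1) ≤ 2 * (1 / 2) := by gcongr; exact h2 _ h0
      _ = 1 := by rw [one_div]; exact ENNReal.mul_inv_cancel (by simp) (by simp)

lemma ee_log_two : ee (Real.log 2) = 2 := by
  rw [ee, Real.exp_log (by norm_num)]; simp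

lemma rpow_le_one_add {v : ℝ≥0∞} {y B : ℝ} (h0 : 0 ≤ y) (hB : y ≤ B) : v ^ y ≤ 1 + v ^ B := by
  rcases le_total v 1 with h | h
  · exact (ENNReal.rpow_le_one h h0).trans le_self_add
  · exact (ENNReal.rpow_le_rpow_of_exponent_le h hB).trans le_add_self

lemma gap_scale {e : (Fin n → ℝ) → ℝ} {B : ℝ} (he1 : ∀ x, 1 ≤ e x) (heB : ∀ x, e x ≤ B)
    {S : Finset ((Fin n → ℝ) × ℝ)} {v : (Fin n → ℝ) × ℝ → ℝ≥0∞} (hv : ∀ P ∈ S, v P ≠ ∞)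
    (h : ∀ θ : ℝ≥0∞, θ ≠ 0 → θ ≤ 1 → ∑ P ∈ S, ∫⁻ x in bl P, (θ * v P) ^ e x ≤ 1 →
      ∑ P ∈ S, ∫⁻ x in bl P, (θ * v P) ^ e x ≤ 1 / 2) :
    ∑ P ∈ S, ∫⁻ x in bl P, v P ^ e x ≤ 1 / 2 := by
  have hB1 : 1 ≤ B := (he1 0).trans (heB 0)
  set σ := Real.log 2 / B with hσ
  have hl2 : 0 < Real.log 2 := Real.log_pos (by norm_num)
  have hσ0 : 0 < σ := by positivity
  have hfin : ∑ P ∈ S, ∫⁻ x in bl P, v P ^ e x ≠ ∞ := by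
    refine (ENNReal.sum_lt_top.2 fun P hP => ?_).ne
    refine lt_of_le_of_lt (lintegral_mono (g := fun _ => 1 + v P ^ B)
      fun x => rpow_le_one_add (by linarith [he1 x]) (heB x)) ?_
    rw [setLIntegral_const]
    refine ENNReal.mul_lt_top (ENNReal.add_lt_top.2 ⟨by simp, ?_⟩) (bl_vol_ne_top P).lt_top
    exact ENNReal.rpow_lt_top_of_nonneg (by linarith) (hv P hP)
  set φ : ℝ≥0∞ → ℝ≥0∞ := fun θ => ∑ P ∈ S, ∫⁻ x in bl P, (θ * v P) ^ e x with hφ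
  have hφ1 : φ 1 = ∑ P ∈ S, ∫⁻ x in bl P, v P ^ e x := by simp [hφ]
  have hle : ∀ k : ℕ, ee (-(σ * k)) ≤ 1 := fun k => by
    rw [← ee_zero, ee_le]; have : 0 ≤ σ * k := by positivity
    linarith
  obtain ⟨M, hM⟩ := ee_surj (a := 1 + φ 1) (by simp) (by rw [hφ1]; simp [hfin])
  obtain ⟨N, hN⟩ := exists_nat_ge (M / σ)
  have key := gap_down (R := fun k : ℕ => φ (ee (-(σ * k)))) ?_
    (fun k hk => h _ (ee_ne_zero _) (hle k) hk) (N := N) ?_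
  · simpa [ee_zero, hφ] using key
  · intro k
    simp only [hφ]
    rw [Finset.mul_sum]
    refine Finset.sum_le_sum fun P hP => ?_
    rw [← lintegral_const_mul' _ _ (by simp)]
    refine lintegral_mono fun x => ?_
    have : ee (-(σ * k)) * v P = ee σ * (ee (-(σ * (k + 1 : ℕ))) * v P) := by
      rw [← mul_assoc, ← ee_add]; congr 2; push_cast; ring
    have h2 : (2:ℝ≥0∞) = ee σ ^ B := by
      rw [ee_rpow, ← ee_log_two]; congr 1; rw [hσ]; field_simp
    rw [this, h2]
    refine rpow_mul_le ?_ (he1 x) (heB x)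
    rw [← ee_zero, ee_le]; exact hσ0.le
  · have : φ (ee (-(σ * N))) ≤ ee (-(σ * N)) * φ 1 := by
      simp only [hφ]
      rw [Finset.mul_sum]
      refine Finset.sum_le_sum fun P hP => ?_
      rw [← lintegral_const_mul' _ _ (ee_ne_top _)]
      refine lintegral_mono fun x => ?_
      rw [one_mul, ENNReal.mul_rpow_of_nonneg _ _ (by linarith [he1 x])]
      gcongr
      rw [ee_rpow, ee_le]
      have : 0 ≤ σ * N := by positivity
      nlinarith [he1 x]
    refine this.trans ?_
    calc ee (-(σ * N)) * φ 1 ≤ ee (-(σ * N)) * ee M := by gcongr; rw [← hM]; exact le_add_self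
      _ = ee (-(σ * N) + M) := (ee_add _ _).symm
      _ ≤ 1 := by
        rw [← ee_zero, ee_le]
        rw [div_le_iff₀ hσ0] at hN
        linarith

lemma young' (a b : ℝ≥0∞) {p q : ℝ} (h : p.HolderConjugate q) : a * b ≤ a ^ p + b ^ q := by
  refine (ENNReal.young_inequality a b h).trans ?_
  gcongr
  · refine ENNReal.div_le_of_le_mul (le_mul_of_one_le_right (by simp) ?_)
    rw [ENNReal.one_le_ofReal]; exact h.lt.le
  · refine ENNReal.div_le_of_le_mul (le_mul_of_one_le_right (by simp) ?_)
    rw [ENNReal.one_le_ofReal]; exact h.symm.lt.le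

/-- conjugate exponent -/
def pc (p : (Fin n → ℝ) → ℝ) (x : Fin n → ℝ) : ℝ := p x / (p x - 1)

lemma pc_conj {p : (Fin n → ℝ) → ℝ} {x : Fin n → ℝ} (h : 1 < p x) :
    (p x).HolderConjugate (pc p x) := Real.HolderConjugate.conjExponent h

lemma pc_meas {p : (Fin n → ℝ) → ℝ} (h : Measurable p) : Measurable (pc p) :=
  h.div (h.sub_const 1)

lemma pc_le {p : (Fin n → ℝ) → ℝ} {c : ℝ} (hc : 1 < c) {x : Fin n → ℝ} (h : c ≤ p x) :
    pc p x ≤ c / (c - 1) := by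
  rw [pc, div_le_div_iff₀ (by linarith) (by linarith)]; nlinarith

lemma av_ne_top_of_modular {e : (Fin n → ℝ) → ℝ} (he1 : ∀ x, 1 ≤ e x)
    {f : (Fin n → ℝ) → ℝ≥0∞} (hf1 : ∫⁻ x, f x ^ e x ≤ 1) {P : (Fin n → ℝ) × ℝ} (hP : 0 < P.2) :
    av f P ≠ ∞ := by
  have : ∫⁻ x in bl P, f x ≤ ∫⁻ x in bl P, (1 + f x ^ e x) := by
    refine lintegral_mono fun x => ?_
    have := rpow_le_one_add (v := f x) (y := 1) (by norm_num) (he1 x)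
    simpa using this
  rw [lintegral_add_left measurable_const, setLIntegral_const] at this
  unfold av
  refine ENNReal.div_ne_top (ne_top_of_le_ne_top ?_ this) (bl_vol_ne_zero hP)
  refine ENNReal.add_ne_top.2 ⟨by simpa using bl_vol_ne_top P, ?_⟩
  exact ne_top_of_le_ne_top (by simp) ((setLIntegral_le_lintegral _ _).trans hf1)

lemma sum_setLIntegral_le {S : Finset ((Fin n → ℝ) × ℝ)}
    (hd : (S : Set ((Fin n → ℝ) × ℝ)).PairwiseDisjoint bl) (g : (Fin n → ℝ) → ℝ≥0∞) :
    ∑ P ∈ S, ∫⁻ x in bl P, g x ≤ ∫⁻ x, g x := by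
  rw [← lintegral_biUnion_finset hd (fun P _ => bl_meas P)]
  exact setLIntegral_le_lintegral _ _

lemma dual {p : (Fin n → ℝ) → ℝ} {C : ℝ≥0∞} {c : ℝ} (h : Amod p C) (hp : Measurable p)
    (hc : 1 < c) (hpc : ∀ x, c ≤ p x) (hC1 : 1 ≤ C) (hC : C ≠ ∞) : Amod (pc p) (4 * C) := by
  intro S hS hd f hf hf1
  have h1p : ∀ x, 1 < p x := fun x => hc.trans_le (hpc x)
  have hcj := fun x => pc_conj (h1p x)
  have hq1 : ∀ x, 1 ≤ pc p x := fun x => (hcj x).symm.lt.le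
  have hC0 : C ≠ 0 := by rintro rfl; simp at hC1
  have h4C0 : 4 * C ≠ 0 := by simp [hC0]
  have h4C : 4 * C ≠ ∞ := ENNReal.mul_ne_top (by simp) hC
  have hg : ∀ P ∈ S, av f P ≠ ∞ := fun P hP => av_ne_top_of_modular hq1 hf1 (hS P hP)
  refine (gap_scale (B := c / (c - 1)) hq1 (fun x => pc_le hc (hpc x))
    (fun P hP => ENNReal.div_ne_top (hg P hP) h4C0) ?_).trans (by norm_num)
  intro θ hθ0 hθ1 hφ
  set v : (Fin n → ℝ) × ℝ → ℝ≥0∞ := fun P => θ * (av f P / (4 * C)) with hv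
  have hvt : ∀ P ∈ S, v P ≠ ∞ := fun P hP => ENNReal.mul_ne_top (ne_top_of_le_ne_top (by simp) hθ1)
    (ENNReal.div_ne_top (hg P hP) h4C0)
  set w : (Fin n → ℝ) × ℝ → (Fin n → ℝ) → ℝ≥0∞ := fun P x => v P ^ (pc p x - 1) with hw
  have hwm : ∀ P, Measurable (w P) := fun P => measurable_const.pow ((pc_meas hp).sub_const 1)
  have hh1 : ∫⁻ x, gl S bl w x ^ p x ≤ 1 := by
    rw [lintegral_gl_rpow hd (fun P _ => bl_meas P) (fun P _ => hwm P) hp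
      (fun x => by linarith [h1p x])]
    refine le_trans (le_of_eq ?_) hφ
    refine Finset.sum_congr rfl fun P hP => lintegral_congr fun x => ?_
    simp only [hw]
    rw [← ENNReal.rpow_mul]
    congr 1
    have := h1p x
    rw [pc]; field_simp [show p x - 1 ≠ 0 by linarith]; ring
  have hA := h S hS hd _ (gl_measurable (fun P _ => bl_meas P) (fun P _ => hwm P)) hh1
  calc ∑ P ∈ S, ∫⁻ x in bl P, v P ^ pc p x
      = ∑ P ∈ S, (θ / 4) * ∫⁻ x in bl P, f x * (av (gl S bl w) P / C) := by
        refine Finset.sum_congr rfl fun P hP => ?_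
        have e1 : ∀ x, v P ^ pc p x = v P * w P x := fun x => by
          simp only [hw]
          by_cases hv0 : v P = 0
          · rw [hv0, zero_mul, ENNReal.zero_rpow_of_pos (by linarith [hq1 x])]
          · conv_rhs => rw [← ENNReal.rpow_one (v P), ← ENNReal.rpow_mul]
            rw [← ENNReal.rpow_add _ _ hv0 (hvt P hP)]
            congr 1; ring
        simp_rw [e1]
        rw [lintegral_const_mul' _ _ (hvt P hP), lintegral_mul_const _ hf,
          av_gl hd hP subset_rfl, ← vol_mul_av f (hS P hP), ← vol_mul_av (w P) (hS P hP)]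
        simp only [hv]
        rw [div_eq_mul_inv, div_eq_mul_inv, div_eq_mul_inv, ENNReal.mul_inv (by simp) (by simp)]
        ring
    _ ≤ ∑ P ∈ S, (θ / 4) * ((∫⁻ x in bl P, f x ^ pc p x) +
          ∫⁻ x in bl P, (av (gl S bl w) P / C) ^ p x) := by
        refine Finset.sum_le_sum fun P hP => ?_
        gcongr
        rw [← lintegral_add_left (hf.pow (pc_meas hp))]
        exact lintegral_mono fun x => young' _ _ (hcj x).symm
    _ = (θ / 4) * ((∑ P ∈ S, ∫⁻ x in bl P, f x ^ pc p x) +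
          ∑ P ∈ S, ∫⁻ x in bl P, (av (gl S bl w) P / C) ^ p x) := by
        rw [← Finset.mul_sum, Finset.sum_add_distrib]
    _ ≤ (1 / 4) * (1 + 1) := by
        gcongr
        exact (sum_setLIntegral_le hd _).trans hf1
    _ = 1 / 2 := by
        rw [show (4:ℝ≥0∞) = 2 * 2 by norm_num, one_div, one_div, one_add_one_eq_two,
          ENNReal.mul_inv (by simp) (by simp), mul_assoc, ENNReal.inv_mul_cancel (by simp) (by simp),
          mul_one]

end fam


section fam2
variable {n : ℕ}

/-- good pairs -/
def good (r : ℝ) (A : ℝ≥0∞) (p : (Fin n → ℝ) → ℝ) (P : (Fin n → ℝ) × ℝ) (u : ℝ≥0∞) : Prop :=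
  av (fun x => (u ^ p x / av (fun x => u ^ p x) P) ^ r) P ≤ A ∧
  av (fun x => (u ^ p x / av (fun x => u ^ p x) P) ^ (-(r / (p x - 1)))) P ≤ A

lemma bad_bound {p : (Fin n → ℝ) → ℝ} {c B : ℝ} (hp : Measurable p)
    (hc : 1 < c) (hpc : ∀ x, c ≤ p x) (hpB : ∀ x, p x ≤ B) {C A : ℝ≥0∞} (hC1 : 1 ≤ C)
    (hC : C ≠ ∞) (hA0 : A ≠ 0) (hAt : A ≠ ∞) {r : ℝ} (hr : 1 < r) {P : (Fin n → ℝ) × ℝ}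
    (hP : 0 < P.2) {u : ℝ≥0∞} (hu0 : u ≠ 0) (hut : u ≠ ∞) (hbad : ¬ good r A p P u) {ω : ℝ≥0∞}
    (hω : ω = av (fun x => u ^ p x) P / u / C) :
    ∫⁻ x in bl P, u ^ p x ≤
      A⁻¹ * (∫⁻ x in bl P, u ^ p x * (u ^ p x / av (fun x => u ^ p x) P) ^ (r - 1)) +
      4⁻¹ * (∫⁻ x in bl P, ω ^ pc p x) +
      (C ^ (c / (c - 1) * r) * 4 ^ (r - 1) * A⁻¹) *
        ∫⁻ x in bl P, ω ^ pc p x * (ω ^ pc p x / av (fun x => ω ^ pc p x) P) ^ (r - 1) := by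
  have h1p : ∀ x, 1 < p x := fun x => hc.trans_le (hpc x)
  have hq1 : ∀ x, 1 ≤ pc p x := fun x => (pc_conj (h1p x)).symm.lt.le
  have hqB : ∀ x, pc p x ≤ c / (c - 1) := fun x => pc_le hc (hpc x)
  have hUne := av_pow_ne (fun x => (h1p x).le) hpB hP hu0 hut
  have hVU := vol_mul_av (fun x => u ^ p x) hP
  set U := av (fun x => u ^ p x) P with hU
  set V := volume (bl P) with hV
  have hV0 : V ≠ 0 := bl_vol_ne_zero hP
  have hVt : V ≠ ∞ := bl_vol_ne_top P
  obtain ⟨m, hm⟩ := ee_surj hUne.1 hUne.2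
  obtain ⟨l, rfl⟩ := ee_surj hu0 hut
  obtain ⟨k, rfl⟩ := ee_surj (a := C) (by rintro rfl; simp at hC1) hC
  have hk : 0 ≤ k := by rwa [← ee_zero, ee_le] at hC1
  obtain ⟨α, rfl⟩ := ee_surj hA0 hAt
  have hω' : ω = ee (m - l - k) := by rw [hω, hm, ← ee_sub, ← ee_sub]
  have hω0 : ω ≠ 0 := by rw [hω']; exact ee_ne_zero _
  have hωt : ω ≠ ∞ := by rw [hω']; exact ee_ne_top _
  have hβne := av_pow_ne hq1 hqB hP hω0 hωt
  have hVβ := vol_mul_av (fun x => ω ^ pc p x) hP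
  set β := av (fun x => ω ^ pc p x) P with hβ
  obtain ⟨z, hz⟩ := ee_surj hβne.1 hβne.2
  rw [← hVU]
  have h4 : (4:ℝ≥0∞) = ee (2 * Real.log 2) := by
    rw [two_mul, ee_add, ee_log_two]; norm_num
  by_cases hb1 : av (fun x => (ee l ^ p x / U) ^ r) P ≤ ee α
  · have hb2 : ee α < av (fun x => (ee l ^ p x / U) ^ (-(r / (p x - 1)))) P := by
      by_contra hcon
      exact hbad ⟨hb1, not_lt.1 hcon⟩
    by_cases hβU : β ≤ 4 * U
    · refine le_trans ?_ le_add_self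
      rw [mul_right_comm, ← div_eq_mul_inv,
        ENNReal.le_div_iff_mul_le (Or.inl (ee_ne_zero _)) (Or.inl (ee_ne_top _))]
      have hzm : z ≤ 2 * Real.log 2 + m := by
        rw [hz, hm, h4, ← ee_add, ee_le] at hβU; exact hβU
      calc V * U * ee α ≤ V * U * av (fun x => (ee l ^ p x / U) ^ (-(r / (p x - 1)))) P := by gcongr
        _ = U * ∫⁻ x in bl P, (ee l ^ p x / U) ^ (-(r / (p x - 1))) := by
          rw [← vol_mul_av _ hP]; ring
        _ = ∫⁻ x in bl P, U * (ee l ^ p x / U) ^ (-(r / (p x - 1))) := by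
          rw [lintegral_const_mul' _ _ hUne.2]
        _ ≤ ∫⁻ x in bl P, ee k ^ (c / (c - 1) * r) * 4 ^ (r - 1) *
              (ω ^ pc p x * (ω ^ pc p x / β) ^ (r - 1)) := by
          refine lintegral_mono fun x => ?_
          rw [h4, hω', hz, hm]
          simp only [ee_rpow, ← ee_sub, ← ee_add]
          rw [ee_le]
          have hpx : 0 < p x - 1 := by linarith [h1p x]
          have e1 : (m - l - k) * pc p x = m - (l * p x - m) / (p x - 1) - k * pc p x := by
            rw [pc]; field_simp; ring
          have e2 : k * pc p x ≤ k * (c / (c - 1)) := mul_le_mul_of_nonneg_left (hqB x) hk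
          have e3 : (l * p x - m) * -(r / (p x - 1)) = - (r * ((l * p x - m) / (p x - 1))) := by
            ring
          rw [e1, e3]
          set y := (l * p x - m) / (p x - 1)
          nlinarith [mul_le_mul_of_nonneg_left e2 (by linarith : 0 ≤ r),
            mul_le_mul_of_nonneg_left hzm (by linarith : 0 ≤ r - 1)]
        _ = _ := by
          rw [lintegral_const_mul' _ _ (by rw [h4, ee_rpow, ee_rpow, ← ee_add]; exact ee_ne_top _)]
    · push Not at hβU
      refine le_trans ?_ (le_add_right le_add_self)
      rw [← ENNReal.div_eq_inv_mul, ENNReal.le_div_iff_mul_le (by simp) (by simp), ← hVβ]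
      calc V * U * 4 = V * (4 * U) := by ring
        _ ≤ V * β := by gcongr
  · push Not at hb1
    refine le_trans ?_ (le_add_right le_self_add)
    rw [← ENNReal.div_eq_inv_mul,
      ENNReal.le_div_iff_mul_le (Or.inl (ee_ne_zero _)) (Or.inl (ee_ne_top _))]
    calc V * U * ee α ≤ V * U * av (fun x => (ee l ^ p x / U) ^ r) P := by gcongr
      _ = U * ∫⁻ x in bl P, (ee l ^ p x / U) ^ r := by
          rw [← vol_mul_av _ hP]; ring
      _ = ∫⁻ x in bl P, U * (ee l ^ p x / U) ^ r := by
          rw [lintegral_const_mul' _ _ hUne.2]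
      _ = _ := by
          refine lintegral_congr fun x => ?_
          rw [hm]
          simp only [ee_rpow, ← ee_sub, ← ee_add]
          congr 1; ring

lemma family {p : (Fin n → ℝ) → ℝ} {c B : ℝ} (hp : Measurable p)
    (hc : 1 < c) (hpc : ∀ x, c ≤ p x) (hpB : ∀ x, p x ≤ B) {C : ℝ≥0∞} (hC1 : 1 ≤ C)
    (hC : C ≠ ∞) (hA : Amod p C) :
    ∃ r : ℝ, 1 < r ∧ ∃ A : ℝ≥0∞, A ≠ ∞ ∧ 1 ≤ A ∧ ∀ S : Finset ((Fin n → ℝ) × ℝ),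
      (∀ P ∈ S, 0 < P.2) → (S : Set ((Fin n → ℝ) × ℝ)).PairwiseDisjoint bl →
      ∀ u : (Fin n → ℝ) × ℝ → ℝ≥0∞, (∀ P ∈ S, u P ≠ 0 ∧ u P ≠ ∞) →
      (∀ P ∈ S, ¬ good r A p P (u P)) → ∑ P ∈ S, ∫⁻ x in bl P, u P ^ p x ≤ 1 →
      ∑ P ∈ S, ∫⁻ x in bl P, u P ^ p x ≤ 1 / 2 := by
  have h1p : ∀ x, 1 < p x := fun x => hc.trans_le (hpc x)
  have hcj := fun x => pc_conj (h1p x)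
  have hq1 : ∀ x, 1 ≤ pc p x := fun x => (pc_conj (h1p x)).symm.lt.le
  have hqB : ∀ x, pc p x ≤ c / (c - 1) := fun x => pc_le hc (hpc x)
  have hA' := dual hA hp hc hpc hC1 hC
  have hC'1 : 1 ≤ 4 * C := hC1.trans (le_mul_of_one_le_left (by simp) (by norm_num))
  have hC' : 4 * C ≠ ∞ := ENNReal.mul_ne_top (by simp) hC
  obtain ⟨r1, hr1, K1, hK1, H1⟩ := RH hA hp (fun x => (h1p x).le) hpB hC1 hC
  obtain ⟨r2, hr2, K2, hK2, H2⟩ := RH hA' (pc_meas hp) hq1 hqB hC'1 hC'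
  set r := min r1 r2 with hr
  have hr1' : 1 < r := lt_min hr1 hr2
  set L : ℝ≥0∞ := (4 * C) ^ (c / (c - 1) * r) * 4 ^ (r - 1) with hL
  have hLt : L ≠ ∞ := by
    refine ENNReal.mul_ne_top (ENNReal.rpow_ne_top_of_nonneg ?_ hC')
      (ENNReal.rpow_ne_top_of_nonneg (by linarith) (by simp))
    have : 0 < c - 1 := by linarith
    positivity
  set Z := K1 + L * K2 + 1 with hZ
  have hZt : Z ≠ ∞ := by simp [hZ, hK1, hLt, hK2, ENNReal.mul_eq_top]
  have hZ1 : 1 ≤ Z := le_add_self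
  have hA1 : 1 ≤ 4 * Z := hZ1.trans (le_mul_of_one_le_left (by simp) (by norm_num))
  refine ⟨r, hr1', 4 * Z, ENNReal.mul_ne_top (by simp) hZt, hA1, ?_⟩
  intro S hS hd u hu hbad hsum
  have hUne : ∀ P ∈ S, _ := fun P hP =>
    av_pow_ne (fun x => (h1p x).le) hpB (hS P hP) (hu P hP).1 (hu P hP).2
  set ω : (Fin n → ℝ) × ℝ → ℝ≥0∞ := fun P => av (fun x => u P ^ p x) P / u P / (4 * C) with hω
  have hω1 : ∑ P ∈ S, ∫⁻ x in bl P, ω P ^ pc p x ≤ 1 := by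
    set w : (Fin n → ℝ) × ℝ → (Fin n → ℝ) → ℝ≥0∞ := fun P x => u P ^ (p x - 1) with hw
    have hwm : ∀ P, Measurable (w P) := fun P => measurable_const.pow (hp.sub_const 1)
    have := hA' S hS hd (gl S bl w) (gl_measurable (fun P _ => bl_meas P) (fun P _ => hwm P)) ?_
    · refine le_trans (le_of_eq ?_) this
      refine Finset.sum_congr rfl fun P hP => ?_
      have : av (gl S bl w) P = av (fun x => u P ^ p x) P / u P := by
        rw [av_gl hd hP subset_rfl, ENNReal.eq_div_iff (hu P hP).1 (hu P hP).2,
          ← av_const_mul _ (hu P hP).2]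
        congr 1; ext x
        simp only [hw]
        conv_lhs => rw [← ENNReal.rpow_one (u P), ← ENNReal.rpow_mul]
        rw [← ENNReal.rpow_add _ _ (hu P hP).1 (hu P hP).2]
        congr 1; ring
      rw [this]
    · rw [lintegral_gl_rpow hd (fun P _ => bl_meas P) (fun P _ => hwm P) (pc_meas hp)
        (fun x => by linarith [hq1 x])]
      refine le_trans (le_of_eq ?_) hsum
      refine Finset.sum_congr rfl fun P hP => lintegral_congr fun x => ?_
      simp only [hw]
      rw [← ENNReal.rpow_mul]
      congr 1
      have := h1p x
      rw [pc]; field_simp [show p x - 1 ≠ 0 by linarith]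
  have hωne : ∀ P ∈ S, ω P ≠ 0 ∧ ω P ≠ ∞ := fun P hP => by
    refine ⟨?_, ?_⟩
    · simp only [hω]
      exact (ENNReal.div_pos (ENNReal.div_pos (hUne P hP).1 (hu P hP).2).ne' hC').ne'
    · simp only [hω]
      exact ENNReal.div_ne_top (ENNReal.div_ne_top (hUne P hP).2 (hu P hP).1)
        (by rintro h0; rw [h0] at hC'1; simp at hC'1)
  have B1 := H1 r hr1'.le (min_le_left _ _) S hS hd u hu hsum
  have B2 := H2 r hr1'.le (min_le_right _ _) S hS hd ω hωne hω1
  have hA0 : 4 * Z ≠ 0 := by rintro h0; rw [h0] at hA1; simp at hA1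
  calc ∑ P ∈ S, ∫⁻ x in bl P, u P ^ p x
      ≤ ∑ P ∈ S, _ := Finset.sum_le_sum fun P hP =>
        bad_bound hp hc hpc hpB hC'1 hC' hA0 (ENNReal.mul_ne_top (by simp) hZt) hr1' (hS P hP)
          (hu P hP).1 (hu P hP).2 (hbad P hP) (ω := ω P) rfl
    _ = _ := by
        rw [Finset.sum_add_distrib, Finset.sum_add_distrib, ← Finset.mul_sum, ← Finset.mul_sum,
          ← Finset.mul_sum]
    _ ≤ (4 * Z)⁻¹ * K1 + 4⁻¹ * 1 + L * (4 * Z)⁻¹ * K2 := by gcongr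
    _ = 4⁻¹ * 1 + (4 * Z)⁻¹ * (K1 + L * K2) := by ring
    _ ≤ 4⁻¹ * 1 + (4 * Z)⁻¹ * Z := by gcongr; exact le_self_add
    _ = 1 / 2 := by
      rw [ENNReal.mul_inv (by simp) (by simp), mul_assoc, ENNReal.inv_mul_cancel
        (by rintro h0; rw [h0] at hZ1; simp at hZ1) hZt, ← mul_add, one_add_one_eq_two,
        show (4:ℝ≥0∞) = 2 * 2 by norm_num, one_div,
          ENNReal.mul_inv (by simp) (by simp), mul_assoc, ENNReal.inv_mul_cancel (by simp) (by simp),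
          mul_one]

end fam2


section gd
variable {n : ℕ}

lemma good_bound {p : (Fin n → ℝ) → ℝ} {c B : ℝ} (hp : Measurable p)
    (hc : 1 < c) (hpc : ∀ x, c ≤ p x) (hpB : ∀ x, p x ≤ B) {A : ℝ≥0∞}
    (hAt : A ≠ ∞) {r : ℝ} (hr : 1 < r) {s γ : ℝ} (hs : s = (1 + r) / 2)
    (hγ : γ = (c - 1) * (1 - s / r)) :
    ∃ K : ℝ≥0∞, K ≠ ∞ ∧ ∀ P : (Fin n → ℝ) × ℝ, 0 < P.2 → ∀ u : ℝ≥0∞, u ≠ 0 → u ≠ ∞ →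
      good r A p P u → ∀ κ : ℝ, 0 ≤ κ → κ ≤ s → ∀ f : (Fin n → ℝ) → ℝ≥0∞, Measurable f →
      u ^ κ ≤ av f P →
      ∫⁻ x in bl P, (u ^ κ) ^ p x ≤ K * ((u ^ κ) ^ γ * ∫⁻ x in bl P, f x ^ (p x - γ)) := by
  have hsr : s < r := by linarith
  have hs0 : 0 < s := by linarith
  have hr0 : 0 < r := by linarith
  have hsr1 : s / r < 1 := by rwa [div_lt_one hr0]
  have hγ0 : 0 < γ := by rw [hγ]; exact mul_pos (by linarith) (by linarith)
  have h1p : ∀ x, 1 < p x := fun x => hc.trans_le (hpc x)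
  have hB1 : 1 < B := (h1p 0).trans_le (hpB 0)
  have hq : ∀ x, s * (p x - 1) ≤ r * (p x - γ - 1) := fun x => by
    have : γ ≤ (p x - 1) * (1 - s / r) := by
      rw [hγ]; exact mul_le_mul_of_nonneg_right (by linarith [hpc x]) (by linarith)
    have h2 : r * ((p x - 1) * (1 - s / r)) = (p x - 1) * (r - s) := by field_simp
    nlinarith
  have hq1 : ∀ x, 1 < p x - γ := fun x => by
    have := hq x
    have h3 : 0 < s * (p x - 1) := mul_pos hs0 (by linarith [h1p x])
    have : 0 < p x - γ - 1 := by
      by_contra hcon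
      push Not at hcon
      nlinarith
    linarith
  obtain ⟨g, hg⟩ := ee_surj (a := 2 * (1 + A)) (by simp) (ENNReal.mul_ne_top (by simp) (by simp [hAt]))
  have hg0 : 0 ≤ g := by
    rw [← ee_le, ee_zero, ← hg]
    calc (1:ℝ≥0∞) ≤ 2 * (1 + 0) := by norm_num
      _ ≤ _ := by gcongr; simp
  set h := g * (B - 1) with hh
  have hh0 : 0 ≤ h := mul_nonneg hg0 (by linarith)
  refine ⟨(1 + A) * (2 * ee h), ENNReal.mul_ne_top (by simp [hAt])
    (ENNReal.mul_ne_top (by simp) (ee_ne_top _)), ?_⟩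
  intro P hP u hu0 hut hgood κ hκ0 hκs f hf htf
  have hUne := av_pow_ne (fun x => (h1p x).le) hpB hP hu0 hut
  obtain ⟨hg1, hg2⟩ := hgood
  set U := av (fun x => u ^ p x) P with hU
  obtain ⟨m, hm⟩ := ee_surj hUne.1 hUne.2
  obtain ⟨l, rfl⟩ := ee_surj hu0 hut
  have hκr : κ ≤ r := by linarith
  -- first part
  have part1 : av (fun x => (ee l ^ κ) ^ p x) P ≤ ee (κ * m) * (1 + A) := by
    calc av (fun x => (ee l ^ κ) ^ p x) P
        ≤ av (fun x => ee (κ * m) * (1 + (ee l ^ p x / U) ^ r)) P := by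
          refine av_mono P fun x => ?_
          have := rpow_le_one_add (v := ee l ^ p x / U) hκ0 hκr
          refine le_trans (le_of_eq ?_) (mul_le_mul' le_rfl this)
          rw [hm]
          simp only [ee_rpow, ← ee_sub, ← ee_add]
          congr 1; ring
      _ = ee (κ * m) * (1 + av (fun x => (ee l ^ p x / U) ^ r) P) := by
          rw [av_const_mul _ (ee_ne_top _), av_add _ measurable_const, av_const _ hP]
      _ ≤ _ := by gcongr
  set q : (Fin n → ℝ) → ℝ := fun x => p x - γ with hqdef
  set ρ := κ * m - γ * (l * κ) with hρ
  have part2 : av (fun x => (ee (-h) * ee (ρ - l * κ)) ^ pc q x) P ≤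
      ee (-h) * ee (-g) * (ee ρ * (1 + A)) := by
    calc av (fun x => (ee (-h) * ee (ρ - l * κ)) ^ pc q x) P
        ≤ av (fun x => (ee (-h) * ee (-g) * ee ρ) * (1 + (ee l ^ p x / U) ^ (-(r / (p x - 1))))) P := by
          refine av_mono P fun x => ?_
          have hpx : 0 < p x - 1 := by linarith [h1p x]
          have hqx : 0 < q x - 1 := by simp only [hqdef]; linarith [hq1 x]
          have := rpow_le_one_add (v := ee (m - l * p x)) (y := κ / (q x - 1)) (B := r / (p x - 1))
            (by positivity) (by
              rw [div_le_div_iff₀ hqx hpx]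
              exact (mul_le_mul_of_nonneg_right hκs hpx.le).trans (hq x))
          have e1 : (ee l ^ p x / U) ^ (-(r / (p x - 1))) = ee (m - l * p x) ^ (r / (p x - 1)) := by
            rw [hm]; simp only [ee_rpow, ← ee_sub]; congr 1; ring
          rw [e1]
          refine le_trans ?_ (mul_le_mul' le_rfl this)
          simp only [ee_rpow, ← ee_add]
          rw [ee_le]
          have e2 : (-h + (ρ - l * κ)) * pc q x =
              ρ + (m - l * p x) * (κ / (q x - 1)) - h - h / (q x - 1) := by
            have hpq : p x = q x + γ := by simp [hqdef]
            rw [pc, hρ, hpq]; field_simp; ring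
          have e3 : g ≤ h / (q x - 1) := by
            rw [le_div_iff₀ hqx, hh]
            refine mul_le_mul_of_nonneg_left ?_ hg0
            simp only [hqdef]; linarith [hpB x]
          linarith
      _ = (ee (-h) * ee (-g) * ee ρ) *
            (1 + av (fun x => (ee l ^ p x / U) ^ (-(r / (p x - 1)))) P) := by
          rw [av_const_mul _ (by rw [← ee_add, ← ee_add]; exact ee_ne_top _),
            av_add _ measurable_const, av_const _ hP]
      _ ≤ (ee (-h) * ee (-g) * ee ρ) * (1 + A) := by gcongr
      _ = _ := by ring
  have part3 : ee (-h) * ee ρ ≤ av (fun x => f x ^ q x) P + ee (-h) * ee ρ / 2 := by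
    calc ee (-h) * ee ρ = (ee (-h) * ee (ρ - l * κ)) * ee l ^ κ := by
          rw [ee_rpow]; simp only [← ee_add]; congr 1; ring
      _ ≤ (ee (-h) * ee (ρ - l * κ)) * av f P := by gcongr
      _ = av (fun x => (ee (-h) * ee (ρ - l * κ)) * f x) P := by
          rw [av_const_mul _ (by rw [← ee_add]; exact ee_ne_top _)]
      _ ≤ av (fun x => f x ^ q x + (ee (-h) * ee (ρ - l * κ)) ^ pc q x) P := by
          refine av_mono P fun x => ?_
          rw [mul_comm]
          exact young' _ _ (pc_conj (hq1 x))
      _ = av (fun x => f x ^ q x) P + av (fun x => (ee (-h) * ee (ρ - l * κ)) ^ pc q x) P :=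
          av_add _ (hf.pow (hp.sub_const γ)) P
      _ ≤ av (fun x => f x ^ q x) P + ee (-h) * ee (-g) * (ee ρ * (1 + A)) := by gcongr
      _ = _ := by
          congr 1
          rw [ee_neg g, ← hg, ENNReal.mul_inv (by simp) (by simp), div_eq_mul_inv]
          have : (1 + A)⁻¹ * (1 + A) = 1 := ENNReal.inv_mul_cancel (by simp) (by simp [hAt])
          calc _ = ee (-h) * ee ρ * 2⁻¹ * ((1 + A)⁻¹ * (1 + A)) := by ring
            _ = _ := by rw [this, mul_one]
  have part4 : ee (-h) * ee ρ / 2 ≤ av (fun x => f x ^ q x) P := by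
    have hfin : ee (-h) * ee ρ / 2 ≠ ∞ :=
      ENNReal.div_ne_top (by rw [← ee_add]; exact ee_ne_top _) (by simp)
    have := part3
    nth_rw 1 [← ENNReal.add_halves (ee (-h) * ee ρ)] at this
    exact (ENNReal.add_le_add_iff_right hfin).1 this
  have part5 : ee ρ ≤ 2 * ee h * av (fun x => f x ^ q x) P := by
    calc ee ρ = 2 * ee h * (ee (-h) * ee ρ / 2) := by
          rw [div_eq_mul_inv]
          have e1 : ee h * ee (-h) = 1 := by rw [← ee_add, add_neg_cancel, ee_zero]
          have e2 : (2:ℝ≥0∞) * 2⁻¹ = 1 := ENNReal.mul_inv_cancel (by simp) (by simp)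
          calc ee ρ = (2 * 2⁻¹) * (ee h * ee (-h)) * ee ρ := by rw [e1, e2]; simp
            _ = _ := by ring
      _ ≤ _ := by gcongr
  rw [← vol_mul_av (fun x => (ee l ^ κ) ^ p x) hP, ← vol_mul_av (fun x => f x ^ (p x - γ)) hP]
  calc volume (bl P) * av (fun x => (ee l ^ κ) ^ p x) P
      ≤ volume (bl P) * (ee (κ * m) * (1 + A)) := by gcongr
    _ = volume (bl P) * (((ee l ^ κ) ^ γ * ee ρ) * (1 + A)) := by
        rw [ee_rpow, ee_rpow, ← ee_add]; congr 3; rw [hρ]; ring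
    _ ≤ volume (bl P) * (((ee l ^ κ) ^ γ * (2 * ee h * av (fun x => f x ^ q x) P)) * (1 + A)) := by
        gcongr
    _ = _ := by simp only [hqdef]; ring

end gd


section lev
variable {n : ℕ}

/-- error term -/
def epsk (s τ : ℝ) : ℝ≥0∞ := if τ < 0 then ee (τ * (1 - 1 / s)) else 0

/-- conclusion of the family lemma -/
def Fam (p : (Fin n → ℝ) → ℝ) (r : ℝ) (A : ℝ≥0∞) : Prop :=
  ∀ S : Finset ((Fin n → ℝ) × ℝ),
      (∀ P ∈ S, 0 < P.2) → (S : Set ((Fin n → ℝ) × ℝ)).PairwiseDisjoint bl →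
      ∀ u : (Fin n → ℝ) × ℝ → ℝ≥0∞, (∀ P ∈ S, u P ≠ 0 ∧ u P ≠ ∞) →
      (∀ P ∈ S, ¬ good r A p P (u P)) → ∑ P ∈ S, ∫⁻ x in bl P, u P ^ p x ≤ 1 →
      ∑ P ∈ S, ∫⁻ x in bl P, u P ^ p x ≤ 1 / 2

lemma exists_good_large {p : (Fin n → ℝ) → ℝ} {B r : ℝ} {A : ℝ≥0∞} (hF : Fam p r A)
    (h1p : ∀ x, 1 ≤ p x) (hpB : ∀ x, p x ≤ B) {s : ℝ} (hs : 1 ≤ s)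
    {P : (Fin n → ℝ) × ℝ} (hP : 0 < P.2) {τ : ℝ} (hτ : 0 ≤ τ)
    (h : ∫⁻ x in bl P, ee τ ^ p x ≤ 1) : ∃ l, τ / s ≤ l ∧ good r A p P (ee l) := by
  by_contra hcon
  push Not at hcon
  have hB1 : 1 ≤ B := (h1p 0).trans (hpB 0)
  have hl2 : 0 < Real.log 2 := Real.log_pos (by norm_num)
  set σ := Real.log 2 / B with hσ
  have hσ0 : 0 < σ := by positivity
  have hτs : 0 ≤ τ / s := by positivity
  have key := gap_up (R := fun j : ℕ => ∫⁻ x in bl P, ee (τ / s + j * σ) ^ p x) ?_ ?_ ?_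
  · obtain ⟨M, hM⟩ := ee_surj (bl_vol_ne_zero hP) (bl_vol_ne_top P)
    obtain ⟨N, hN⟩ := exists_nat_ge (-M / σ)
    have h1 : (1:ℝ≥0∞) ≤ ∫⁻ x in bl P, ee (τ / s + N * σ) ^ p x := by
      calc (1:ℝ≥0∞) ≤ ee (N * σ) * volume (bl P) := by
            rw [hM, ← ee_add, ← ee_zero, ee_le]
            rw [div_le_iff₀ hσ0] at hN; linarith
        _ = ∫⁻ x in bl P, ee (N * σ) := by rw [setLIntegral_const]
        _ ≤ _ := by
            refine lintegral_mono fun x => ?_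
            simp only [ee_rpow]
            rw [ee_le]
            have h3 : 0 ≤ N * σ := by positivity
            nlinarith [h1p x, mul_le_mul_of_nonneg_left (h1p x) (add_nonneg hτs h3)]
    have := h1.trans (key N)
    rw [one_div] at this
    exact absurd this (by simp)
  · refine le_trans (lintegral_mono fun x => ?_) h
    simp only [Nat.cast_zero, zero_mul, add_zero]
    refine rpow_mono_base ?_ (by linarith [h1p x])
    rw [ee_le]
    exact div_le_self hτ hs
  · intro k
    rw [← lintegral_const_mul' _ _ (by simp)]
    refine lintegral_mono fun x => ?_
    simp only [ee_rpow]
    rw [← ee_log_two, ← ee_add, ee_le]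
    have : σ * p x ≤ Real.log 2 := by
      calc σ * p x ≤ σ * B := mul_le_mul_of_nonneg_left (hpB x) hσ0.le
        _ = Real.log 2 := by rw [hσ]; field_simp
    push_cast
    nlinarith
  · intro k hk
    have := hF {P} (by simpa using hP) (by simp) (fun _ => ee (τ / s + k * σ))
      (fun _ _ => ⟨ee_ne_zero _, ee_ne_top _⟩) ?_ (by simpa using hk)
    · simpa using this
    · intro Q hQ
      rw [Finset.mem_singleton] at hQ
      subst hQ
      exact hcon _ (by have : 0 ≤ k * σ := by positivity
                       linarith)

lemma level_sum {p : (Fin n → ℝ) → ℝ} {B r : ℝ} {A K : ℝ≥0∞} (hF : Fam p r A)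
    (h1p : ∀ x, 1 ≤ p x) (hpB : ∀ x, p x ≤ B) {s γ : ℝ} (hs : 1 < s)
    (hK : ∀ P : (Fin n → ℝ) × ℝ, 0 < P.2 → ∀ u : ℝ≥0∞, u ≠ 0 → u ≠ ∞ →
      good r A p P u → ∀ κ : ℝ, 0 ≤ κ → κ ≤ s → ∀ f : (Fin n → ℝ) → ℝ≥0∞, Measurable f →
      u ^ κ ≤ av f P →
      ∫⁻ x in bl P, (u ^ κ) ^ p x ≤ K * ((u ^ κ) ^ γ * ∫⁻ x in bl P, f x ^ (p x - γ)))
    {g : (Fin n → ℝ) → ℝ≥0∞} (hg : Measurable g) {τ : ℝ}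
    {S : Finset ((Fin n → ℝ) × ℝ)} (hS : ∀ P ∈ S, 0 < P.2)
    (hd : (S : Set ((Fin n → ℝ) × ℝ)).PairwiseDisjoint bl)
    (hav : ∀ P ∈ S, ee τ ≤ av g P)
    (hsum : ∀ P ∈ S, ∫⁻ x in bl P, ee τ ^ p x ≤ 1) :
    ∑ P ∈ S, ∫⁻ x in bl P, ee τ ^ p x ≤
      K * (ee τ ^ γ * ∫⁻ x, g x ^ (p x - γ)) + epsk s τ := by
  classical
  have main : ∀ T ⊆ S, (∀ P ∈ T, ∃ l κ : ℝ, good r A p P (ee l) ∧ 0 ≤ κ ∧ κ ≤ s ∧ l * κ = τ) →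
      ∑ P ∈ T, ∫⁻ x in bl P, ee τ ^ p x ≤ K * (ee τ ^ γ * ∫⁻ x, g x ^ (p x - γ)) := by
    intro T hT h
    calc ∑ P ∈ T, ∫⁻ x in bl P, ee τ ^ p x
        ≤ ∑ P ∈ T, K * (ee τ ^ γ * ∫⁻ x in bl P, g x ^ (p x - γ)) := by
          refine Finset.sum_le_sum fun P hP => ?_
          obtain ⟨l, κ, h1, h2, h3, h4⟩ := h P hP
          have := hK P (hS P (hT hP)) (ee l) (ee_ne_zero _) (ee_ne_top _) h1 κ h2 h3 g hg
          rw [ee_rpow, h4] at this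
          exact this (hav P (hT hP))
      _ = K * (ee τ ^ γ * ∑ P ∈ T, ∫⁻ x in bl P, g x ^ (p x - γ)) := by
          rw [← Finset.mul_sum, ← Finset.mul_sum]
      _ ≤ _ := by
          gcongr
          exact sum_setLIntegral_le (hd.subset hT) _
  have hs0 : 0 < s := by linarith
  rcases le_or_gt 0 τ with hτ | hτ
  · refine (main S subset_rfl fun P hP => ?_).trans le_self_add
    obtain ⟨l, hl, hgd⟩ := exists_good_large hF h1p hpB hs.le (hS P hP) hτ (hsum P hP)
    rw [div_le_iff₀ hs0] at hl
    refine ⟨l, τ / l, hgd, ?_⟩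
    have hl0 : 0 ≤ l := by
      by_contra hcon
      push Not at hcon
      nlinarith
    rcases hl0.eq_or_lt with h0 | h0
    · subst h0
      have : τ = 0 := by linarith
      simp [this, hs0.le]
    · refine ⟨by positivity, ?_, by field_simp⟩
      rw [div_le_iff₀ h0]; linarith
  · set T := S.filter fun P => ∃ l, l ≤ τ / s ∧ good r A p P (ee l) with hT
    rw [← Finset.sum_filter_add_sum_filter_not S
      (fun P => ∃ l, l ≤ τ / s ∧ good r A p P (ee l))]
    refine add_le_add (main _ (Finset.filter_subset _ _) fun P hP => ?_) ?_
    · obtain ⟨l, hl, hgd⟩ := (Finset.mem_filter.1 hP).2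
      have hl0 : l < 0 := hl.trans_lt (div_neg_of_neg_of_pos hτ hs0)
      rw [le_div_iff₀ hs0] at hl
      refine ⟨l, τ / l, hgd, (div_pos_of_neg_of_neg hτ hl0).le, ?_, ?_⟩
      · rw [div_le_iff_of_neg hl0]; linarith
      · have := hl0.ne
        field_simp
    · set T' := S.filter fun P => ¬ ∃ l, l ≤ τ / s ∧ good r A p P (ee l) with hT'
      have hT'S : T' ⊆ S := Finset.filter_subset _ _
      have h1 : ∑ P ∈ T', ∫⁻ x in bl P, ee (τ / s) ^ p x ≤ 1 / 2 := by
        refine gap_scale (v := fun _ => ee (τ / s)) h1p hpB (fun _ _ => ee_ne_top _) ?_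
        intro θ hθ0 hθ1 hθ
        obtain ⟨y, rfl⟩ := ee_surj hθ0 (ne_top_of_le_ne_top (by simp) hθ1)
        rw [← ee_zero, ee_le] at hθ1
        rw [← ee_add] at hθ ⊢
        refine hF T' (fun P hP => hS P (hT'S hP)) (hd.subset hT'S)
          (fun _ => ee (y + τ / s)) (fun _ _ => ⟨ee_ne_zero _, ee_ne_top _⟩) ?_ hθ
        intro P hP hgd
        exact (Finset.mem_filter.1 hP).2 ⟨_, by linarith, hgd⟩
      calc ∑ P ∈ T', ∫⁻ x in bl P, ee τ ^ p x
          ≤ ∑ P ∈ T', ee (τ * (1 - 1 / s)) * ∫⁻ x in bl P, ee (τ / s) ^ p x := by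
            refine Finset.sum_le_sum fun P _ => ?_
            rw [← lintegral_const_mul' _ _ (ee_ne_top _)]
            refine lintegral_mono fun x => ?_
            simp only [ee_rpow]
            rw [← ee_add, ee_le]
            have h3 : 0 ≤ 1 - 1 / s := by
              rw [sub_nonneg, div_le_one hs0]; exact hs.le
            have h4 : τ * (1 - 1 / s) ≤ 0 := mul_nonpos_of_nonpos_of_nonneg hτ.le h3
            have h5 : τ * p x = τ / s * p x + τ * (1 - 1 / s) * p x := by field_simp; ring
            nlinarith [h1p x]
        _ = ee (τ * (1 - 1 / s)) * ∑ P ∈ T', ∫⁻ x in bl P, ee (τ / s) ^ p x := by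
            rw [← Finset.mul_sum]
        _ ≤ ee (τ * (1 - 1 / s)) * 1 := by gcongr; exact h1.trans (by simp)
        _ = epsk s τ := by rw [mul_one, epsk, if_pos hτ]

end lev


section lev2
variable {n : ℕ}

/-- the Besicovitch covering property with `N` families -/
def Besi (n N : ℕ) : Prop :=
  ∀ G : Set ((Fin n → ℝ) × ℝ), (∀ P ∈ G, 0 < P.2) → (∃ R : ℝ, ∀ P ∈ G, P.2 ≤ R) →
    ∃ s : Fin N → Set ((Fin n → ℝ) × ℝ), (∀ i, s i ⊆ G) ∧ (∀ i, (s i).PairwiseDisjoint bl) ∧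
      ∀ P ∈ G, P.1 ∈ ⋃ i, ⋃ Q ∈ s i, bl Q

lemma besi (n : ℕ) : ∃ N, Besi n N := by
  obtain ⟨N, τ, hτ, hN⟩ := HasBesicovitchCovering.no_satelliteConfig (α := Fin n → ℝ)
  refine ⟨N, fun G hG ⟨R, hR⟩ => ?_⟩
  obtain ⟨s, hs, hc⟩ := Besicovitch.exist_disjoint_covering_families hτ hN
    (β := G) { c := fun Q => Q.1.1, r := fun Q => Q.1.2, rpos := fun Q => hG _ Q.2,
               r_bound := R, r_le := fun Q => hR _ Q.2 }
  refine ⟨fun i => Subtype.val '' s i, ?_, ?_, ?_⟩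
  · rintro i _ ⟨Q, _, rfl⟩
    exact Q.2
  · rintro i _ ⟨Q, hQ, rfl⟩ _ ⟨Q', hQ', rfl⟩ hne
    have := hs i hQ hQ' (fun h => hne (by rw [h]))
    exact this.mono Metric.ball_subset_closedBall Metric.ball_subset_closedBall
  · intro P hP
    have := hc ⟨⟨P, hP⟩, rfl⟩
    simp only [mem_iUnion] at this ⊢
    obtain ⟨i, Q, hQ, hx⟩ := this
    exact ⟨i, Q.1, ⟨Q, hQ, rfl⟩, hx⟩

lemma level {N : ℕ} (hn : n ≠ 0) (hN : Besi n N)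
    {p : (Fin n → ℝ) → ℝ} {B r : ℝ} {A K : ℝ≥0∞} (hF : Fam p r A)
    (h1p : ∀ x, 1 ≤ p x) (hpB : ∀ x, p x ≤ B) {s γ : ℝ} (hs : 1 < s)
    (hK : ∀ P : (Fin n → ℝ) × ℝ, 0 < P.2 → ∀ u : ℝ≥0∞, u ≠ 0 → u ≠ ∞ →
      good r A p P u → ∀ κ : ℝ, 0 ≤ κ → κ ≤ s → ∀ f : (Fin n → ℝ) → ℝ≥0∞, Measurable f →
      u ^ κ ≤ av f P →
      ∫⁻ x in bl P, (u ^ κ) ^ p x ≤ K * ((u ^ κ) ^ γ * ∫⁻ x in bl P, f x ^ (p x - γ)))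
    {C : ℝ≥0∞} (hC1 : 1 ≤ C) (hC : C ≠ ∞) (hA : Amod p C)
    {f : (Fin n → ℝ) → ℝ≥0∞} (hf : Measurable f) (hf1 : ∫⁻ x, (C * f x) ^ p x ≤ 1) (τ : ℝ) :
    ∃ W : Set (Fin n → ℝ), MeasurableSet W ∧
      (∀ x ρ, 0 < ρ → 2 * ee τ < av f (x, ρ) → x ∈ W) ∧
      ∫⁻ x in W, ee τ ^ p x ≤
        N * (K * (ee τ ^ γ * ∫⁻ x, ({x | ee τ < f x}.indicator f x) ^ (p x - γ)) + epsk s τ) := by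
  set g := {x | ee τ < f x}.indicator f with hgdef
  have hset : MeasurableSet {x | ee τ < f x} := measurableSet_lt measurable_const hf
  have hg : Measurable g := hf.indicator hset
  have hC0 : C ≠ 0 := by rintro rfl; simp at hC1
  have hfg : ∀ x, f x ≤ ee τ + g x := by
    intro x
    by_cases hx : ee τ < f x
    · rw [hgdef, indicator_of_mem (by exact hx)]; exact le_add_self
    · exact (not_lt.1 hx).trans le_self_add
  set G : Set ((Fin n → ℝ) × ℝ) := {P | 0 < P.2 ∧ 2 * ee τ < av f P} with hG
  have hG1 : ∀ P ∈ G, ee τ ≤ av g P := by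
    rintro P ⟨h0, h2⟩
    have h3 : av f P ≤ ee τ + av g P := by
      calc av f P ≤ av (fun x => ee τ + g x) P := av_mono P hfg
        _ = _ := by rw [av_add _ measurable_const, av_const _ h0]
    have h4 := h2.le.trans h3
    rw [two_mul] at h4
    exact (ENNReal.add_le_add_iff_left (ee_ne_top τ)).1 h4
  have hG2 : ∀ P ∈ G, ∫⁻ x in bl P, ee τ ^ p x ≤ 1 := by
    rintro P ⟨h0, h2⟩
    have := hA {P} (by simpa using h0) (by simp) (fun x => C * f x) (hf.const_mul C) hf1
    rw [Finset.sum_singleton] at this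
    refine le_trans (lintegral_mono fun x => ?_) this
    refine rpow_mono_base ?_ (by linarith [h1p x])
    rw [av_const_mul _ hC, mul_comm C, ENNReal.mul_div_cancel_right hC0 hC]
    exact le_trans (le_mul_of_one_le_left (by simp) (by norm_num)) h2.le
  have hB : 1 ≤ B := (h1p 0).trans (hpB 0)
  have hG3 : ∃ R : ℝ, ∀ P ∈ G, P.2 ≤ R := by
    refine ⟨Real.exp (|τ| * B), fun P hP => ?_⟩
    have h1 : ee (-(|τ| * B)) * volume (bl P) ≤ 1 := by
      refine le_trans ?_ (hG2 P hP)
      rw [← setLIntegral_const]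
      refine lintegral_mono fun x => ?_
      simp only [ee_rpow]
      rw [ee_le]
      have h2 : -|τ| ≤ τ := neg_abs_le τ
      have h3 : |τ| * p x ≤ |τ| * B := mul_le_mul_of_nonneg_left (hpB x) (abs_nonneg τ)
      nlinarith [h1p x, mul_le_mul_of_nonneg_right h2 (by linarith [h1p x] : 0 ≤ p x)]
    rw [bl_vol hP.1, ee, ← ENNReal.ofReal_mul (Real.exp_pos _).le, ENNReal.ofReal_le_one,
      Real.exp_neg, inv_mul_le_iff₀ (Real.exp_pos _), mul_one] at h1
    by_contra hcon
    push Not at hcon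
    have h4 : (1:ℝ) ≤ Real.exp (|τ| * B) := Real.one_le_exp (by positivity)
    have h5 : 2 * P.2 ≤ (2 * P.2) ^ n := le_self_pow₀ (by linarith) hn
    linarith
  obtain ⟨S, hSG, hSd, hcov⟩ := hN G (fun P hP => hP.1) hG3
  have hcount : ∀ i, (S i).Countable := fun i =>
    (hSd i).countable_of_isOpen (fun P _ => bl_isOpen P)
      (fun P hP => Metric.nonempty_ball.2 (hSG i hP).1)
  refine ⟨⋃ i, ⋃ Q ∈ S i, bl Q, ?_, ?_, ?_⟩
  · exact (isOpen_iUnion fun i => isOpen_biUnion fun Q _ => bl_isOpen Q).measurableSet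
  · intro x ρ hρ h
    exact hcov (x, ρ) ⟨hρ, h⟩
  · refine (lintegral_iUnion_le _ _).trans ?_
    rw [tsum_fintype]
    refine (Finset.sum_le_card_nsmul _ _
      (K * (ee τ ^ γ * ∫⁻ x, (g x) ^ (p x - γ)) + epsk s τ) fun i _ => ?_).trans ?_
    · rw [lintegral_biUnion (hcount i) (fun P _ => bl_meas P) (hSd i)]
      refine tsum_le_of_finset (g := fun P => ∫⁻ x in bl P, ee τ ^ p x) fun T hT => ?_
      exact level_sum hF h1p hpB hs hK hg (fun P hP => (hSG i (hT hP)).1)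
        ((hSd i).subset hT) (fun P hP => hG1 P (hSG i (hT hP)))
        (fun P hP => hG2 P (hSG i (hT hP)))
    · rw [Finset.card_univ, Fintype.card_fin, nsmul_eq_mul]

end lev2


section mx
variable {n : ℕ}

lemma geo {δ : ℝ} (hδ : 0 < δ) : ∃ D : ℝ≥0∞, D ≠ 0 ∧ D ≠ ∞ ∧ ∀ y : ℝ,
    ∑' k : ℤ, (if (k : ℝ) < y then ee (k * δ) else 0) ≤ D * ee (y * δ) := by
  have hlt : ee (-δ) < 1 := by rw [← ee_zero, ee_lt]; linarith
  refine ⟨ee δ * (1 - ee (-δ))⁻¹, ?_, ?_, fun y => ?_⟩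
  · refine mul_ne_zero (ee_ne_zero _) (ENNReal.inv_ne_zero.2 ?_)
    exact (tsub_le_self.trans_lt one_lt_top).ne
  · refine ENNReal.mul_ne_top (ee_ne_top _) (ENNReal.inv_ne_top.2 ?_)
    exact (tsub_pos_of_lt hlt).ne'
  · have hinj : Function.Injective (fun j : ℕ => ⌈y⌉ - (j : ℤ)) := by
      intro a b h; simp only at h; omega
    rw [← hinj.tsum_eq (f := fun k : ℤ => (if (k : ℝ) < y then ee (k * δ) else 0))]
    · calc ∑' j : ℕ, (if ((⌈y⌉ - (j : ℤ) : ℤ) : ℝ) < y then ee ((⌈y⌉ - (j : ℤ) : ℤ) * δ) else 0)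
          ≤ ∑' j : ℕ, ee (⌈y⌉ * δ) * ee (-δ) ^ j := by
            refine ENNReal.tsum_le_tsum fun j => ?_
            split_ifs
            · rw [← ENNReal.rpow_natCast, ee_rpow, ← ee_add, ee_le]
              push_cast
              linarith
            · exact zero_le
        _ = ee (⌈y⌉ * δ) * (1 - ee (-δ))⁻¹ := by
            rw [ENNReal.tsum_mul_left, ENNReal.tsum_geometric]
        _ ≤ (ee δ * ee (y * δ)) * (1 - ee (-δ))⁻¹ := by
            gcongr
            rw [← ee_add, ee_le]
            nlinarith [(Int.ceil_lt_add_one y).le]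
        _ = _ := by ring
    · intro k hk
      simp only [Function.mem_support, ne_eq, ite_eq_right_iff, not_forall] at hk
      obtain ⟨h1, _⟩ := hk
      have : k ≤ ⌈y⌉ := by
        have := h1.le.trans (Int.le_ceil y)
        exact_mod_cast this
      exact ⟨(⌈y⌉ - k).toNat, by simp only; omega⟩

/-- centered maximal function -/
def Mb (f : (Fin n → ℝ) → ℝ≥0∞) (x : Fin n → ℝ) : ℝ≥0∞ := ⨆ (ρ : ℝ) (_ : 0 < ρ), av f (x, ρ)

lemma Mb_pointwise' {f : (Fin n → ℝ) → ℝ≥0∞} {q : ℝ} (hq : 1 ≤ q) {x : Fin n → ℝ}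
    {W : ℤ → Set (Fin n → ℝ)} (hW : ∀ k : ℤ, ∀ ρ, 0 < ρ → 2 * ee k < av f (x, ρ) → x ∈ W k) :
    Mb f x ^ q ≤ ∑' k : ℤ, (W k).indicator (fun _ => (2 * ee 1 * ee k) ^ q) x := by
  have hq0 : 0 < q := by linarith
  refine le_of_forall_lt_imp_le_of_dense fun z hz => ?_
  have hz1 : z ^ q⁻¹ < Mb f x := by
    rwa [ENNReal.rpow_inv_lt_iff hq0]
  rcases eq_or_ne z 0 with rfl | hz0
  · exact zero_le
  obtain ⟨y, hy⟩ := ee_surj (a := z ^ q⁻¹)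
    (by simp [ENNReal.rpow_eq_zero_iff, hz0, hq0.le, hq0]) (hz1.trans_le le_top).ne
  set k : ℤ := ⌈y - Real.log 2⌉ - 1 with hk
  have hk1 : (k : ℝ) < y - Real.log 2 := by
    rw [hk]; push_cast; linarith [Int.ceil_lt_add_one (y - Real.log 2)]
  have hk2 : y - Real.log 2 ≤ k + 1 := by
    rw [hk]; push_cast; linarith [Int.le_ceil (y - Real.log 2)]
  have h1 : 2 * ee k < Mb f x := by
    refine lt_of_le_of_lt ?_ hz1
    rw [hy, ← ee_log_two, ← ee_add, ee_le]; linarith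
  simp only [Mb, lt_iSup_iff] at h1
  obtain ⟨ρ, hρ, h2⟩ := h1
  have hx := hW k ρ hρ h2
  refine le_trans ?_ (ENNReal.le_tsum k)
  rw [indicator_of_mem hx, ← ENNReal.rpow_inv_le_iff hq0, hy, ← ee_log_two, ← ee_add, ← ee_add,
    ee_le]
  linarith

lemma sum_levels {γ : ℝ} {D : ℝ≥0∞} (hD0 : D ≠ 0)
    (hD : ∀ y : ℝ, ∑' k : ℤ, (if (k : ℝ) < y then ee (k * γ) else 0) ≤ D * ee (y * γ))
    {q : ℝ} (hq : γ < q) (hγ : 0 < γ) (f : (Fin n → ℝ) → ℝ≥0∞) (x : Fin n → ℝ) :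
    ∑' k : ℤ, ee k ^ γ * ({x | ee k < f x}.indicator f x) ^ (q - γ) ≤ D * f x ^ q := by
  have hqg : 0 < q - γ := by linarith
  rcases eq_or_ne (f x) ∞ with ht | ht
  · rw [ht, ENNReal.top_rpow_of_pos (by linarith), ENNReal.mul_top hD0]; exact le_top
  rcases eq_or_ne (f x) 0 with h0 | h0
  · have : ∀ k : ℤ, ee k ^ γ * ({x | ee k < f x}.indicator f x) ^ (q - γ) = 0 := by
      intro k
      rw [indicator_of_notMem (by simp [h0]), ENNReal.zero_rpow_of_pos hqg, mul_zero]
    simp [this]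
  obtain ⟨y, hy⟩ := ee_surj h0 ht
  calc ∑' k : ℤ, ee k ^ γ * ({x | ee k < f x}.indicator f x) ^ (q - γ)
      = ∑' k : ℤ, (if (k : ℝ) < y then ee (k * γ) else 0) * ee (y * (q - γ)) := by
        refine tsum_congr fun k => ?_
        by_cases hk : (k : ℝ) < y
        · rw [if_pos hk, indicator_of_mem (by simp only [mem_ofPred_eq]; rwa [hy, ee_lt]), hy,
            ee_rpow, ee_rpow]
        · rw [if_neg hk, indicator_of_notMem (by simp only [mem_ofPred_eq]; rwa [hy, ee_lt]),
            ENNReal.zero_rpow_of_pos hqg, mul_zero, zero_mul]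
    _ = (∑' k : ℤ, (if (k : ℝ) < y then ee (k * γ) else 0)) * ee (y * (q - γ)) :=
        ENNReal.tsum_mul_right
    _ ≤ D * ee (y * γ) * ee (y * (q - γ)) := by gcongr; exact hD y
    _ = D * f x ^ q := by
        rw [mul_assoc, ← ee_add, hy, ee_rpow]; congr 2; ring

theorem modular_bound (hn : n ≠ 0) {p : (Fin n → ℝ) → ℝ} {c B : ℝ} (hp : Measurable p)
    (hc : 1 < c) (hpc : ∀ x, c ≤ p x) (hpB : ∀ x, p x ≤ B) {C : ℝ≥0∞} (hC1 : 1 ≤ C)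
    (hC : C ≠ ∞) (hA : Amod p C) :
    ∃ K : ℝ≥0∞, K ≠ ∞ ∧ ∀ f : (Fin n → ℝ) → ℝ≥0∞, Measurable f →
      ∫⁻ x, (C * f x) ^ p x ≤ 1 → ∫⁻ x, Mb f x ^ p x ≤ K := by
  obtain ⟨r, hr, A, hAt, hA1, hF⟩ := family hp hc hpc hpB hC1 hC hA
  obtain ⟨s, hs⟩ : ∃ s, s = (1 + r) / 2 := ⟨_, rfl⟩
  obtain ⟨γ, hγ⟩ : ∃ γ, γ = (c - 1) * (1 - s / r) := ⟨_, rfl⟩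
  obtain ⟨K, hKt, hK⟩ := good_bound hp hc hpc hpB hAt hr hs hγ
  obtain ⟨N, hN⟩ := besi n
  have hs1 : 1 < s := by linarith
  have hr0 : 0 < r := by linarith
  have hsr1 : s / r < 1 := by rw [div_lt_one hr0]; linarith
  have hsr0 : 0 < s / r := by positivity
  have hγ0 : 0 < γ := by rw [hγ]; exact mul_pos (by linarith) (by linarith)
  have hγp : ∀ x, γ < p x := by
    intro x
    have : γ ≤ c - 1 := by rw [hγ]; nlinarith
    linarith [hpc x]
  have h1p : ∀ x, 1 ≤ p x := fun x => hc.le.trans (hpc x)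
  obtain ⟨D, hD0, hDt, hD⟩ := geo hγ0
  have hδ : 0 < 1 - 1 / s := by
    have : 1 / s < 1 := by rw [div_lt_one (by linarith)]; exact hs1
    linarith
  obtain ⟨D', -, hDt', hD'⟩ := geo hδ
  have hB0 : 0 ≤ B := by linarith [h1p 0, hpB 0]
  refine ⟨(2 * ee 1) ^ B * (N * (K * D + D')), ?_, fun f hf hf1 => ?_⟩
  · refine ENNReal.mul_ne_top (ENNReal.rpow_ne_top_of_nonneg hB0
      (ENNReal.mul_ne_top (by simp) (ee_ne_top _))) (ENNReal.mul_ne_top (by simp) ?_)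
    exact ENNReal.add_ne_top.2 ⟨ENNReal.mul_ne_top hKt hDt, hDt'⟩
  choose W hWm hWc hWi using fun k : ℤ => level hn hN hF h1p hpB hs1 hK hC1 hC hA hf hf1 (k : ℝ)
  have h2e : (1 : ℝ≥0∞) ≤ 2 * ee 1 := by
    rw [← ee_log_two, ← ee_add, ← ee_zero, ee_le]
    have := Real.log_pos (one_lt_two); linarith
  have hmeas : ∀ k : ℤ, Measurable fun x => ee k ^ γ * ({x | ee k < f x}.indicator f x) ^ (p x - γ) := by
    intro k
    exact ((hf.indicator (measurableSet_lt measurable_const hf)).pow (hp.sub_const γ)).const_mul _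
  calc ∫⁻ x, Mb f x ^ p x
      ≤ ∫⁻ x, ∑' k : ℤ, (W k).indicator (fun y => (2 * ee 1 * ee k) ^ p y) x := by
        refine lintegral_mono fun x => ?_
        refine (Mb_pointwise' (h1p x) (W := W) fun k ρ hρ h => hWc k x ρ hρ h).trans_eq ?_
        refine tsum_congr fun k => ?_
        by_cases hx : x ∈ W k
        · simp only [indicator_of_mem hx]
        · simp only [indicator_of_notMem hx]
    _ = ∑' k : ℤ, ∫⁻ x in W k, (2 * ee 1 * ee k) ^ p x := by
        rw [lintegral_tsum fun k => ((measurable_const.pow hp).indicator (hWm k)).aemeasurable]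
        refine tsum_congr fun k => ?_
        rw [lintegral_indicator (hWm k)]
    _ ≤ ∑' k : ℤ, (2 * ee 1) ^ B * (N * (K * (∫⁻ x, ee k ^ γ *
          ({x | ee k < f x}.indicator f x) ^ (p x - γ)) + epsk s k)) := by
        refine ENNReal.tsum_le_tsum fun k => ?_
        calc ∫⁻ x in W k, (2 * ee 1 * ee k) ^ p x
            ≤ ∫⁻ x in W k, (2 * ee 1) ^ B * ee k ^ p x := by
              exact lintegral_mono fun x => rpow_mul_le h2e (h1p x) (hpB x)
          _ = (2 * ee 1) ^ B * ∫⁻ x in W k, ee k ^ p x := by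
              rw [lintegral_const_mul _ (measurable_const.pow hp)]
          _ ≤ _ := by
              rw [lintegral_const_mul _
                ((hf.indicator (measurableSet_lt measurable_const hf)).pow (hp.sub_const γ))]
              gcongr
              exact hWi k
    _ = (2 * ee 1) ^ B * (N * (K * (∫⁻ x, ∑' k : ℤ, ee k ^ γ *
          ({x | ee k < f x}.indicator f x) ^ (p x - γ)) + ∑' k : ℤ, epsk s k)) := by
        rw [ENNReal.tsum_mul_left, ENNReal.tsum_mul_left, ENNReal.tsum_add, ENNReal.tsum_mul_left,
          lintegral_tsum fun k => (hmeas k).aemeasurable]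
    _ ≤ _ := by
        gcongr
        · calc (∫⁻ x, ∑' k : ℤ, ee k ^ γ * ({x | ee k < f x}.indicator f x) ^ (p x - γ))
              ≤ ∫⁻ x, D * f x ^ p x := 
                lintegral_mono fun x => sum_levels hD0 hD (hγp x) hγ0 f x
            _ ≤ D * 1 := by
                rw [lintegral_const_mul _ (hf.pow hp)]
                gcongr
                refine le_trans (lintegral_mono fun x => ?_) hf1
                exact rpow_mono_base (le_mul_of_one_le_left (by simp) hC1) (by linarith [h1p x])
            _ = D := mul_one _
        · have := hD' 0
          rw [zero_mul, ee_zero, mul_one] at this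
          exact this

end mx


section red
variable {n : ℕ}

lemma toSet_eq (Q : RCube n) : Q.toSet = Metric.closedBall Q.center (Q.side / 2) := by
  ext x
  rw [Metric.mem_closedBall, dist_pi_le_iff (by linarith [Q.side_pos])]
  rfl

lemma vnorm_mono {p : (Fin n → ℝ) → ℝ} (hp : ∀ x, 0 < p x) {f g : (Fin n → ℝ) → ℝ≥0∞}
    (h : ∀ x, f x ≤ g x) : vnorm p f ≤ vnorm p g := by
  refine sInf_le_sInf fun lam hl => ⟨hl.1, le_trans (lintegral_mono fun x => ?_) hl.2⟩
  exact rpow_mono_base (by gcongr; exact h x) (hp x)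

lemma vnorm_congr_exp {p q : (Fin n → ℝ) → ℝ} (h : p =ᵐ[volume] q) (f : (Fin n → ℝ) → ℝ≥0∞) :
    vnorm p f = vnorm q f := by
  unfold vnorm
  congr 1
  ext lam
  have : (∫⁻ x, (f x / lam) ^ p x) = ∫⁻ x, (f x / lam) ^ q x :=
    lintegral_congr_ae (h.mono fun x hx => by simp only [hx])
  simp only [mem_ofPred_eq, this]

lemma vnorm_le {p : (Fin n → ℝ) → ℝ} {f : (Fin n → ℝ) → ℝ≥0∞} {lam : ℝ≥0∞} (h0 : 0 < lam)
    (h : (∫⁻ x, (f x / lam) ^ p x) ≤ 1) : vnorm p f ≤ lam := sInf_le ⟨h0, h⟩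

lemma modular_of_lt {p : (Fin n → ℝ) → ℝ} (hp : ∀ x, 0 < p x) {f : (Fin n → ℝ) → ℝ≥0∞}
    {lam : ℝ≥0∞} (h : vnorm p f < lam) : (∫⁻ x, (f x / lam) ^ p x) ≤ 1 := by
  obtain ⟨mu, ⟨_, h1⟩, h2⟩ := sInf_lt_iff.1 h
  refine le_trans (lintegral_mono fun x => ?_) h1
  exact rpow_mono_base (ENNReal.div_le_div_left h2.le _) (hp x)

/-- shrunken closed cubes -/
def cb (k : ℕ) (P : (Fin n → ℝ) × ℝ) : Set (Fin n → ℝ) :=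
  Metric.closedBall P.1 ((1 - 1 / ((k : ℝ) + 2)) * P.2)

lemma th_pos (k : ℕ) : (0:ℝ) < 1 - 1 / ((k : ℝ) + 2) := by
  have : (1:ℝ) / ((k : ℝ) + 2) < 1 := by rw [div_lt_one (by positivity)]; linarith [k.cast_nonneg (α := ℝ)]
  linarith

lemma cb_mono {P : (Fin n → ℝ) × ℝ} (h : 0 < P.2) : Monotone fun k => cb k P := by
  intro k l hkl
  refine Metric.closedBall_subset_closedBall ?_
  gcongr

lemma cb_subset {P : (Fin n → ℝ) × ℝ} (h : 0 < P.2) (k : ℕ) : cb k P ⊆ bl P := by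
  refine Metric.closedBall_subset_ball ?_
  have : (0:ℝ) < 1 / ((k : ℝ) + 2) := by positivity
  nlinarith

lemma cb_iUnion {P : (Fin n → ℝ) × ℝ} (h : 0 < P.2) : ⋃ k, cb k P = bl P := by
  refine Subset.antisymm (iUnion_subset fun k => cb_subset h k) fun x hx => ?_
  rw [bl, Metric.mem_ball] at hx
  rw [mem_iUnion]
  have h1 : 0 < 1 - dist x P.1 / P.2 := by
    have : dist x P.1 / P.2 < 1 := by rwa [div_lt_one h]
    linarith
  obtain ⟨k, hk⟩ := exists_nat_one_div_lt h1
  refine ⟨k, ?_⟩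
  rw [cb, Metric.mem_closedBall]
  have h2 : (1:ℝ) / ((k : ℝ) + 2) ≤ 1 / ((k : ℝ) + 1) := by
    gcongr; norm_num
  have h3 : dist x P.1 / P.2 ≤ 1 - 1 / ((k : ℝ) + 2) := by linarith
  rwa [div_le_iff₀ h] at h3

lemma cb_meas (k : ℕ) (P : (Fin n → ℝ) × ℝ) : MeasurableSet (cb k P) :=
  Metric.isClosed_closedBall.measurableSet

lemma amod_of_hyp {p : (Fin n → ℝ) → ℝ} (hp : Measurable p) (h1p : ∀ x, 1 ≤ p x) {C : ℝ}
    (H : ∀ F : Set (RCube n), PairwiseDisjointCubes F →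
        ∀ f : (Fin n → ℝ) → ℝ, Measurable f → vnorm p (ofR f) < ∞ →
          vnorm p (avgSum F f) ≤ ENNReal.ofReal C * vnorm p (ofR f)) :
    Amod p (ENNReal.ofReal C + 1) := by
  intro S hS hd f hf hf1
  have h0p : ∀ x, 0 < p x := fun x => by linarith [h1p x]
  have hfin : ∀ᵐ x, f x < ∞ := by
    have := ae_lt_top (hf.pow hp) (hf1.trans_lt one_lt_top).ne
    filter_upwards [this] with x hx
    by_contra hcon
    rw [not_lt, top_le_iff] at hcon
    rw [hcon, ENNReal.top_rpow_of_pos (h0p x)] at hx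
    exact lt_irrefl _ hx
  have hR : vnorm p (ofR fun x => (f x).toReal) ≤ 1 := by
    refine vnorm_le one_pos ?_
    refine le_trans (lintegral_mono fun x => ?_) hf1
    refine rpow_mono_base ?_ (h0p x)
    rw [div_one, ofR, abs_of_nonneg ENNReal.toReal_nonneg]
    exact ENNReal.ofReal_toReal_le
  have hfinI : ∀ P ∈ S, ∫⁻ x in bl P, f x ≠ ∞ := by
    intro P hP
    rw [← vol_mul_av f (hS P hP)]
    exact ENNReal.mul_ne_top (bl_vol_ne_top P) (av_ne_top_of_modular h1p hf1 (hS P hP))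
  have hdk : ∀ k, (S : Set ((Fin n → ℝ) × ℝ)).PairwiseDisjoint (cb k) := fun k P hP Q hQ hne =>
    (hd hP hQ hne).mono (cb_subset (hS P hP) k) (cb_subset (hS Q hQ) k)
  set C' := ENNReal.ofReal C + 1 with hC'
  have hC'0 : C' ≠ 0 := by rw [hC']; simp
  have hC't : C' ≠ ∞ := by rw [hC']; simp
  set a : ℕ → (Fin n → ℝ) × ℝ → ℝ≥0∞ := fun k P =>
    (∫⁻ x in cb k P, f x) / volume (bl P) / C' with ha
  -- the bound for each k
  have hk : ∀ k, ∫⁻ x, gl S (cb k) (fun P x => a k P ^ p x) x ≤ 1 := by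
    intro k
    set F : Set (RCube n) := {Q | ∃ P ∈ S, Q.center = P.1 ∧
      Q.side = 2 * ((1 - 1 / ((k : ℝ) + 2)) * P.2)} with hF
    have hFs : ∀ Q : RCube n, ∀ P : (Fin n → ℝ) × ℝ, Q.center = P.1 →
        Q.side = 2 * ((1 - 1 / ((k : ℝ) + 2)) * P.2) → Q.toSet = cb k P := by
      intro Q P h1 h2
      rw [toSet_eq, h1, h2, cb]; congr 1; ring
    have hFd : PairwiseDisjointCubes F := by
      rintro Q ⟨P, hP, h1, h2⟩ Q' ⟨P', hP', h1', h2'⟩ hne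
      rw [hFs Q P h1 h2, hFs Q' P' h1' h2']
      refine hdk k hP hP' ?_
      rintro rfl
      apply hne
      cases Q; cases Q'
      simp only at h1 h2 h1' h2'
      subst h1 h2 h1' h2'
      rfl
    have h1 := H F hFd (fun x => (f x).toReal) hf.ennreal_toReal (hR.trans_lt one_lt_top)
    have h2 : vnorm p (avgSum F fun x => (f x).toReal) < C' := by
      calc _ ≤ ENNReal.ofReal C * 1 := h1.trans (by gcongr)
        _ < C' := by
          rw [mul_one, hC']
          exact ENNReal.lt_add_right (by simp) (by simp)
    refine le_trans (lintegral_mono fun x => ?_) (modular_of_lt h0p h2)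
    by_cases hx : ∃ P ∈ S, x ∈ cb k P
    · obtain ⟨P, hP, hxP⟩ := hx
      simp only
      rw [gl_of_mem (hdk k) hP hxP]
      refine rpow_mono_base ?_ (h0p x)
      refine ENNReal.div_le_div_right ?_ C'
      have hpos : 0 < 2 * ((1 - 1 / ((k : ℝ) + 2)) * P.2) :=
        mul_pos two_pos (mul_pos (th_pos k) (hS P hP))
      let Q : RCube n := ⟨P.1, _, hpos⟩
      have hQ : Q.toSet = cb k P := hFs Q P rfl rfl
      refine le_trans ?_ (le_iSup₂_of_le Q ⟨P, hP, rfl, rfl⟩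
        (le_iSup_of_le (by rw [hQ]; exact hxP) le_rfl))
      rw [cubeAvg, hQ, integral_toReal hf.aemeasurable (ae_restrict_of_ae hfin),
        ← ENNReal.toReal_div, abs_of_nonneg ENNReal.toReal_nonneg, ENNReal.ofReal_toReal]
      · exact ENNReal.div_le_div_left (measure_mono (cb_subset (hS P hP) k)) _
      · refine (ENNReal.div_lt_top ?_ ?_).ne
        · exact ((lintegral_mono_set (cb_subset (hS P hP) k)).trans_lt
            (lt_top_iff_ne_top.2 (hfinI P hP))).ne
        · exact (Metric.measure_closedBall_pos _ _ (mul_pos (th_pos k) (hS P hP))).ne'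
    · push Not at hx
      simp only
      rw [gl_of_notMem hx]; exact zero_le
  have hta : ∀ P ∈ S, Filter.Tendsto (fun k => a k P) Filter.atTop (nhds (av f P / C')) := by
    intro P hP
    have h1 : Filter.Tendsto (fun k => ∫⁻ x in cb k P, f x) Filter.atTop
        (nhds (∫⁻ x in bl P, f x)) := by
      have := tendsto_measure_iUnion_atTop (μ := volume.withDensity f) (cb_mono (hS P hP))
      rw [cb_iUnion (hS P hP), withDensity_apply _ (bl_meas P)] at this
      refine this.congr fun k => ?_
      simp only [Function.comp]
      rw [withDensity_apply _ (cb_meas k P)]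
    have h2 := ENNReal.Tendsto.div_const h1 (Or.inr (bl_vol_ne_zero (hS P hP)))
    exact ENNReal.Tendsto.div_const h2 (Or.inr hC'0)
  have hlim : ∀ x, Filter.Tendsto (fun k => gl S (cb k) (fun P x => a k P ^ p x) x) Filter.atTop
      (nhds (gl S bl (fun P x => (av f P / C') ^ p x) x)) := by
    intro x
    unfold gl
    refine tendsto_finsetSum _ fun P hP => ?_
    by_cases hx : x ∈ bl P
    · rw [indicator_of_mem hx]
      have h1 := ((ENNReal.continuous_rpow_const (y := p x)).tendsto _).comp (hta P hP)
      refine h1.congr' ?_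
      have hx' := hx
      rw [← cb_iUnion (hS P hP), mem_iUnion] at hx'
      obtain ⟨k, hk⟩ := hx'
      filter_upwards [Filter.eventually_ge_atTop k] with l hl
      rw [indicator_of_mem (cb_mono (hS P hP) hl hk)]
      rfl
    · rw [indicator_of_notMem hx]
      refine tendsto_const_nhds.congr fun k => ?_
      rw [indicator_of_notMem fun h => hx (cb_subset (hS P hP) k h)]
  rw [← lintegral_gl (u := fun P x => (av f P / C') ^ p x) (fun P _ => bl_meas P)
    (fun P _ => measurable_const.pow hp)]
  calc ∫⁻ x, gl S bl (fun P x => (av f P / C') ^ p x) x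
      = ∫⁻ x, Filter.liminf (fun k => gl S (cb k) (fun P x => a k P ^ p x) x) Filter.atTop :=
        lintegral_congr fun x => (hlim x).liminf_eq.symm
    _ ≤ Filter.liminf (fun k => ∫⁻ x, gl S (cb k) (fun P x => a k P ^ p x) x) Filter.atTop :=
        lintegral_liminf_le fun k => gl_measurable (fun P _ => cb_meas k P)
          (fun P _ => measurable_const.pow hp)
    _ ≤ 1 := by
        refine Filter.liminf_le_of_le (by isBoundedDefault) fun b hb => ?_
        obtain ⟨k, h⟩ := hb.exists
        exact h.trans (hk k)

end red


section fin
variable {n : ℕ}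

lemma toSet_vol (Q : RCube n) : volume Q.toSet = ENNReal.ofReal (Q.side ^ n) := by
  rw [toSet_eq, Real.volume_pi_closedBall _ (by linarith [Q.side_pos]), Fintype.card_fin]
  congr 2; ring

lemma toSet_vol_ne_zero (Q : RCube n) : volume Q.toSet ≠ 0 := by
  rw [toSet_vol, ne_eq, ENNReal.ofReal_eq_zero, not_le]
  exact pow_pos Q.side_pos n

lemma toSet_vol_ne_top (Q : RCube n) : volume Q.toSet ≠ ∞ := by
  rw [toSet_vol]; exact ENNReal.ofReal_ne_top

lemma avgSum_le (F : Set (RCube n)) (f : (Fin n → ℝ) → ℝ) (x : Fin n → ℝ) :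
    avgSum F f x ≤ hlMaximal f x := by
  refine iSup_le fun Q => iSup_le fun _ => iSup_le fun hx => ?_
  refine le_trans ?_ (le_iSup₂_of_le Q hx le_rfl)
  have hv : 0 < (volume Q.toSet).toReal := ENNReal.toReal_pos (toSet_vol_ne_zero Q) (toSet_vol_ne_top Q)
  rw [cubeAvg, abs_div, abs_of_pos hv, ENNReal.ofReal_div_of_pos hv,
    ENNReal.ofReal_toReal (toSet_vol_ne_top Q)]
  refine ENNReal.div_le_div_right ?_ _
  have := enorm_integral_le_lintegral_enorm (μ := volume.restrict Q.toSet) f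
  simpa only [Real.enorm_eq_ofReal_abs] using this

lemma hl_le (f : (Fin n → ℝ) → ℝ) (x : Fin n → ℝ) :
    hlMaximal f x ≤ 2 ^ n * Mb (ofR f) x := by
  refine iSup_le fun Q => iSup_le fun hx => ?_
  have hs := Q.side_pos
  have h1 : av (ofR f) (x, Q.side) ≤ Mb (ofR f) x := le_iSup₂_of_le Q.side hs le_rfl
  refine le_trans ?_ (mul_le_mul_right h1 _)
  rw [ENNReal.div_le_iff (toSet_vol_ne_zero Q) (toSet_vol_ne_top Q)]
  have h2 : volume (bl (x, Q.side)) = 2 ^ n * volume Q.toSet := by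
    rw [bl_vol (by exact hs), toSet_vol, mul_pow, ENNReal.ofReal_mul (by positivity),
      ENNReal.ofReal_pow (by norm_num)]
    simp
  calc ∫⁻ y in Q.toSet, ENNReal.ofReal |f y|
      ≤ ∫⁻ y in Metric.closedBall x Q.side, ofR f y := by
        refine lintegral_mono_set ?_
        rw [toSet_eq] at hx ⊢
        intro y hy
        rw [Metric.mem_closedBall] at *
        have := dist_triangle_right y x Q.center
        linarith
    _ = ∫⁻ y in bl (x, Q.side), ofR f y :=
        (setLIntegral_congr (bl_ae_closedBall (P := (x, Q.side)) hs)).symm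
    _ = volume (bl (x, Q.side)) * av (ofR f) (x, Q.side) := (vol_mul_av _ (by exact hs)).symm
    _ = _ := by rw [h2]; ring

lemma Mb_const_mul {a : ℝ≥0∞} (ha : a ≠ ∞) (f : (Fin n → ℝ) → ℝ≥0∞) (x : Fin n → ℝ) :
    Mb (fun y => a * f y) x = a * Mb f x := by
  unfold Mb
  simp only [ENNReal.mul_iSup, av_const_mul a ha]

theorem norm_bound {p : (Fin n → ℝ) → ℝ} (h1p : ∀ x, 1 ≤ p x) {C K : ℝ≥0∞} (hC1 : 1 ≤ C)
    (hC : C ≠ ∞) (hK : K ≠ ∞) (h : ∀ f : (Fin n → ℝ) → ℝ≥0∞, Measurable f →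
      ∫⁻ x, (C * f x) ^ p x ≤ 1 → ∫⁻ x, Mb f x ^ p x ≤ K) (hp : Measurable p) :
    MaximalBounded p := by
  have h0p : ∀ x, 0 < p x := fun x => by linarith [h1p x]
  have hC0 : C ≠ 0 := by rintro rfl; simp at hC1
  set K' := K + 1 with hK'
  have hK'0 : K' ≠ 0 := by simp [hK']
  have hK't : K' ≠ ∞ := by simp [hK', hK]
  have hK'1 : 1 ≤ K' := le_add_self
  set D : ℝ≥0∞ := 2 ^ n * C * K' with hD
  have hD0 : D ≠ 0 := by simp [hD, hC0, hK'0]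
  have hDt : D ≠ ∞ := by
    rw [hD]
    exact ENNReal.mul_ne_top (ENNReal.mul_ne_top (by simp) hC) hK't
  refine ⟨D.toReal, ENNReal.toReal_pos hD0 hDt, fun f hf hfin => ?_⟩
  rw [ENNReal.ofReal_toReal hDt, mul_comm, ← ENNReal.div_le_iff hD0 hDt]
  refine le_of_forall_gt_imp_ge_of_dense fun lam hlam => ?_
  rcases eq_or_ne lam ∞ with rfl | hlt
  · exact le_top
  have hl0 : lam ≠ 0 := (zero_le.trans_lt hlam).ne'
  rw [ENNReal.div_le_iff hD0 hDt]
  refine vnorm_le (by rw [pos_iff_ne_zero]; exact mul_ne_zero hl0 hD0) ?_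
  have hfm : Measurable (ofR f) := (hf.abs).ennreal_ofReal
  have hinv : (C * lam)⁻¹ ≠ ∞ := ENNReal.inv_ne_top.2 (mul_ne_zero hC0 hl0)
  have h1 := h (fun x => (C * lam)⁻¹ * ofR f x) (hfm.const_mul _) (by
    refine le_trans (le_of_eq (lintegral_congr fun x => ?_)) (modular_of_lt h0p hlam)
    congr 1
    rw [ENNReal.mul_inv (Or.inl hC0) (Or.inl hC), ← mul_assoc, ← mul_assoc,
      ENNReal.mul_inv_cancel hC0 hC, one_mul, mul_comm, div_eq_mul_inv])
  have h2 : ∀ x, K' * (hlMaximal f x / (lam * D)) ^ p x ≤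
      Mb (fun x => (C * lam)⁻¹ * ofR f x) x ^ p x := by
    intro x
    refine (rpow_mul_ge hK'1 (h1p x)).trans (rpow_mono_base ?_ (h0p x))
    rw [Mb_const_mul hinv]
    calc K' * (hlMaximal f x / (lam * D))
        ≤ K' * ((2 ^ n * Mb (ofR f) x) / (lam * D)) := by gcongr; exact hl_le f x
      _ = (C * lam)⁻¹ * Mb (ofR f) x := by
        have e : lam * D = (C * lam) * (2 ^ n * K') := by rw [hD]; ring
        have h3 : (2:ℝ≥0∞) ^ n * K' ≠ 0 := mul_ne_zero (by simp) hK'0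
        have h4 : (2:ℝ≥0∞) ^ n * K' ≠ ∞ := ENNReal.mul_ne_top (by simp) hK't
        rw [e, div_eq_mul_inv, ENNReal.mul_inv (Or.inr h4) (Or.inr h3)]
        calc K' * (2 ^ n * Mb (ofR f) x * ((C * lam)⁻¹ * (2 ^ n * K')⁻¹))
            = ((2 ^ n * K') * (2 ^ n * K')⁻¹) * ((C * lam)⁻¹ * Mb (ofR f) x) := by ring
          _ = _ := by rw [ENNReal.mul_inv_cancel h3 h4, one_mul]
  have h3 : K' * ∫⁻ x, (hlMaximal f x / (lam * D)) ^ p x ≤ K' * 1 := by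
    rw [← lintegral_const_mul' _ _ hK't, mul_one]
    exact (lintegral_mono h2).trans (h1.trans le_self_add)
  exact (ENNReal.mul_le_mul_iff_right hK'0 hK't).1 h3

lemma zero_dim {p : (Fin 0 → ℝ) → ℝ} (h0p : ∀ x, 0 < p x) : MaximalBounded p := by
  refine ⟨1, one_pos, fun f _ _ => ?_⟩
  rw [ENNReal.ofReal_one, one_mul]
  refine vnorm_mono h0p fun x => ?_
  refine iSup_le fun Q => iSup_le fun hx => ?_
  have : ∀ y, ENNReal.ofReal |f y| = ofR f x := fun y => by rw [Subsingleton.elim y x]; rfl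
  simp only [this]
  rw [setLIntegral_const, ENNReal.mul_div_cancel_right (toSet_vol_ne_zero Q) (toSet_vol_ne_top Q)]

end fin

theorem statement14 {n : ℕ} (p : (Fin n → ℝ) → ℝ) (hpm : Measurable p)
    (hp1 : ∀ x, 1 ≤ p x)
    (hlow : ∃ c : ℝ, 1 < c ∧ ∀ᵐ x ∂(volume : Measure (Fin n → ℝ)), c ≤ p x)
    (hup : ∃ B : ℝ, ∀ᵐ x ∂(volume : Measure (Fin n → ℝ)), p x ≤ B) :
    MaximalBounded p ↔ ∃ C : ℝ, 0 < C ∧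
      ∀ F : Set (RCube n), PairwiseDisjointCubes F →
        ∀ f : (Fin n → ℝ) → ℝ, Measurable f → vnorm p (ofR f) < ∞ →
          vnorm p (avgSum F f) ≤ ENNReal.ofReal C * vnorm p (ofR f) := by
  have h0p : ∀ x, 0 < p x := fun x => by linarith [hp1 x]
  constructor
  · rintro ⟨C, hC, h⟩
    exact ⟨C, hC, fun F _ f hf hfin => (vnorm_mono h0p (avgSum_le F f)).trans (h f hf hfin)⟩
  · rintro ⟨C, hC, H⟩
    rcases Nat.eq_zero_or_pos n with rfl | hn
    · exact zero_dim h0p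
    obtain ⟨c, hc, hcp⟩ := hlow
    obtain ⟨B, hB⟩ := hup
    set q : (Fin n → ℝ) → ℝ := fun x => max c (min (p x) (max B c)) with hq
    have hpq : p =ᵐ[volume] q := by
      filter_upwards [hcp, hB] with x h1 h2
      simp only [hq]
      rw [min_eq_left (h2.trans (le_max_left _ _)), max_eq_right h1]
    have hqm : Measurable q := measurable_const.max (hpm.min measurable_const)
    have hqc : ∀ x, c ≤ q x := fun x => le_max_left _ _
    have hqB : ∀ x, q x ≤ max B c := fun x => max_le (le_max_right _ _) (min_le_right _ _)
    have hq1 : ∀ x, 1 ≤ q x := fun x => hc.le.trans (hqc x)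
    simp only [MaximalBounded, vnorm_congr_exp hpq] at H ⊢
    have hA := amod_of_hyp hqm hq1 H
    have hCt : ENNReal.ofReal C + 1 ≠ ∞ := by simp
    obtain ⟨K, hK, hb⟩ := modular_bound hn.ne' hqm hc hqc hqB le_add_self hCt hA
    exact norm_bound hq1 le_add_self hCt hK hb hqm
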